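/- Let K be an algebraically closed field of characteristic 0, H ⊆ G normal, and ρ: G → GL(V) a representation such that the Zariski closure M_H of ρ(H) is connected and semisimple. If ρ is semisimple with all simple constituents remaining simple on H and having finite determinant, then the inclusion M_H → Mo(ρ)⁰ into the identity component of the Zariski closure of ρ(G) is an isomorphism. -/

import Mathlib

section Preamble

variable (K : Type*) [Field K] (V : Type*) [AddCommGroup V] [Module K V]

/-- The algebra of polynomial functions on `End(V) × End(V)` (recording an endomorphism
together with its inverse), i.e. the subalgebra of functions generated by linear
functionals.  Zero loci of such functions are the Zariski-closed subsets of `GL(V)`. -/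
def endPairPolynomials : Subalgebra K (((V →ₗ[K] V) × (V →ₗ[K] V)) → K) :=
  Algebra.adjoin K (Set.range fun φ : ((V →ₗ[K] V) × (V →ₗ[K] V)) →ₗ[K] K => (φ : _ → K))

variable {K V}

/-- A subset of `GL(V)` is Zariski closed if it is the zero locus of a set of polynomial
functions in the matrix entries of `g` and `g⁻¹`. -/
def IsZarClosed (C : Set (V ≃ₗ[K] V)) : Prop :=
  ∃ T : Set (((V →ₗ[K] V) × (V →ₗ[K] V)) → K),
    (∀ f ∈ T, f ∈ endPairPolynomials K V) ∧
    C = {g : V ≃ₗ[K] V | ∀ f ∈ T,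
      f ((g : V →ₗ[K] V), ((g⁻¹ : V ≃ₗ[K] V) : V →ₗ[K] V)) = 0}

/-- The Zariski closure of a subset of `GL(V)` as an algebraic subgroup: the smallest
Zariski-closed subgroup containing it. -/
def zarSubgroupClosure (S : Set (V ≃ₗ[K] V)) : Subgroup (V ≃ₗ[K] V) :=
  ⨅ H ∈ {H : Subgroup (V ≃ₗ[K] V) | S ⊆ (H : Set (V ≃ₗ[K] V)) ∧
    IsZarClosed (H : Set (V ≃ₗ[K] V))}, H

/-- The Zariski closure `Mo(ρ)` of the image of a representation `ρ : G → GL(V)`. -/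
def monodromyGroup {G : Type*} [Group G] (ρ : G →* (V ≃ₗ[K] V)) :
    Subgroup (V ≃ₗ[K] V) :=
  zarSubgroupClosure (Set.range ρ)

/-- The identity component of an algebraic subgroup of `GL(V)`: the smallest
Zariski-closed finite-index subgroup. -/
def identityComponent (M : Subgroup (V ≃ₗ[K] V)) : Subgroup (V ≃ₗ[K] V) :=
  ⨅ H ∈ {H : Subgroup (V ≃ₗ[K] V) | H ≤ M ∧ IsZarClosed (H : Set (V ≃ₗ[K] V)) ∧
    (H.subgroupOf M).FiniteIndex}, H

/-- A connected algebraic subgroup of `GL(V)`. -/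
def IsConnectedAlgGroup (M : Subgroup (V ≃ₗ[K] V)) : Prop :=
  IsZarClosed (M : Set (V ≃ₗ[K] V)) ∧ identityComponent M = M

/-- A (connected) semisimple algebraic subgroup of `GL(V)`: a connected Zariski-closed
subgroup with no nontrivial Zariski-closed connected normal abelian subgroup. -/
def IsSemisimpleAlgGroup (M : Subgroup (V ≃ₗ[K] V)) : Prop :=
  IsConnectedAlgGroup M ∧
  ∀ W : Subgroup (V ≃ₗ[K] V), W ≤ M → IsZarClosed (W : Set (V ≃ₗ[K] V)) →
    identityComponent W = W →
    (∀ g ∈ M, ∀ w ∈ W, g * w * g⁻¹ ∈ W) →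
    (∀ a ∈ W, ∀ b ∈ W, a * b = b * a) → W = ⊥

variable {G : Type*} [Group G]

/-- A submodule invariant under the action of a subgroup `G' ⊆ G` via `ρ`. -/
def IsInvariantOn (ρ : G →* (V ≃ₗ[K] V)) (G' : Subgroup G) (p : Submodule K V) : Prop :=
  ∀ g ∈ G', ∀ v ∈ p, ρ g v ∈ p

/-- The restriction `ρ|_{G'}` is semisimple: every invariant submodule has an invariant
complement. -/
def IsSemisimpleOn (ρ : G →* (V ≃ₗ[K] V)) (G' : Subgroup G) : Prop :=
  ∀ p : Submodule K V, IsInvariantOn ρ G' p →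
    ∃ q : Submodule K V, IsInvariantOn ρ G' q ∧ IsCompl p q

/-- `p` is a simple constituent for the action of `G'` via `ρ`. -/
def IsSimpleOn (ρ : G →* (V ≃ₗ[K] V)) (G' : Subgroup G) (p : Submodule K V) : Prop :=
  IsInvariantOn ρ G' p ∧ p ≠ ⊥ ∧
  ∀ q ≤ p, IsInvariantOn ρ G' q → q = ⊥ ∨ q = p

/-- The determinant character of the action of `G'` on the invariant submodule `p`
has finite order. -/
def HasFiniteDetOn (ρ : G →* (V ≃ₗ[K] V)) (G' : Subgroup G) (p : Submodule K V) : Prop :=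
  ∃ m : ℕ, 0 < m ∧ ∀ g ∈ G', ∀ h : ∀ v ∈ p, ρ g v ∈ p,
    (LinearMap.det ((ρ g : V →ₗ[K] V).restrict h)) ^ m = 1

/-- The restriction `ρ|_{G'}` is admissible: it is semisimple and all its simple
constituents have finite-order determinant. -/
def IsAdmissibleOn (ρ : G →* (V ≃ₗ[K] V)) (G' : Subgroup G) : Prop :=
  IsSemisimpleOn ρ G' ∧ ∀ p : Submodule K V, IsSimpleOn ρ G' p → HasFiniteDetOn ρ G' p

end Preamble

namespace MatrixGroup

open Matrix MvPolynomial

set_option linter.unusedSectionVars false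

variable {ι K : Type*} [Fintype ι] [DecidableEq ι] [Field K]

/-- Polynomials in the entries of a matrix and of a second matrix, thought of as its inverse. -/
abbrev CoordRing (ι K : Type*) [Field K] := MvPolynomial ((ι × ι) ⊕ (ι × ι)) K

variable (ι K) in
/-- The generic matrix. -/
noncomputable def genX : Matrix ι ι (CoordRing ι K) := of fun i j => X (Sum.inl (i, j))

variable (ι K) in
/-- The generic inverse matrix. -/
noncomputable def genY : Matrix ι ι (CoordRing ι K) := of fun i j => X (Sum.inr (i, j))

/-- A scalar matrix as a matrix of constant polynomials. -/
noncomputable def const (A : Matrix ι ι K) : Matrix ι ι (CoordRing ι K) := A.map C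

section Evaluation

variable {R : Type*} [CommRing R] [Algebra K R]

/-- Evaluation of a coordinate polynomial at a pair of matrices. -/
noncomputable def evalPair (A B : Matrix ι ι R) : CoordRing ι K →ₐ[K] R :=
  aeval (Sum.elim (fun p => A p.1 p.2) (fun p => B p.1 p.2))

@[simp] lemma evalPair_genX (A B : Matrix ι ι R) (i j : ι) :
    evalPair (K := K) A B (genX ι K i j) = A i j := by
  simp [evalPair, genX]

@[simp] lemma evalPair_genY (A B : Matrix ι ι R) (i j : ι) :
    evalPair (K := K) A B (genY ι K i j) = B i j := by
  simp [evalPair, genY]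

@[simp] lemma map_evalPair_genX (A B : Matrix ι ι R) :
    (genX ι K).map (evalPair A B) = A := by
  ext; simp

@[simp] lemma map_evalPair_genY (A B : Matrix ι ι R) :
    (genY ι K).map (evalPair A B) = B := by
  ext; simp

lemma algHom_ext_gen {f g : CoordRing ι K →ₐ[K] R}
    (hX : (genX ι K).map f = (genX ι K).map g) (hY : (genY ι K).map f = (genY ι K).map g) :
    f = g := by
  refine MvPolynomial.algHom_ext fun s => ?_
  rcases s with ⟨i, j⟩ | ⟨i, j⟩
  · exact congrFun (congrFun hX i) j
  · exact congrFun (congrFun hY i) j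

end Evaluation

@[simp] lemma map_const (f : CoordRing ι K →ₐ[K] CoordRing ι K) (A : Matrix ι ι K) :
    (const A).map f = const A := by
  refine Matrix.ext fun i j => ?_
  exact f.commutes (A i j)

@[simp] lemma map_const_scalar (f : CoordRing ι K →ₐ[K] K) (A : Matrix ι ι K) :
    (const A).map f = A := by
  ext i j
  exact f.commutes (A i j)

lemma const_mul (A B : Matrix ι ι K) : const (A * B) = const A * const B :=
  Matrix.map_mul (f := (C : K →+* CoordRing ι K))

@[simp] lemma const_one : const (1 : Matrix ι ι K) = 1 :=
  Matrix.map_one _ (map_zero _) (map_one _)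

/-- Evaluation of a coordinate polynomial at an invertible matrix. -/
noncomputable def ev (g : GL ι K) : CoordRing ι K →ₐ[K] K :=
  evalPair (g : Matrix ι ι K) ((g⁻¹ : GL ι K) : Matrix ι ι K)

@[simp] lemma map_ev_genX (g : GL ι K) : (genX ι K).map (ev g) = (g : Matrix ι ι K) :=
  map_evalPair_genX _ _

@[simp] lemma map_ev_genY (g : GL ι K) :
    (genY ι K).map (ev g) = ((g⁻¹ : GL ι K) : Matrix ι ι K) :=
  map_evalPair_genY _ _

/-- The substitution `u ↦ g * u * h` on coordinate polynomials. -/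
noncomputable def trans (g h : GL ι K) : CoordRing ι K →ₐ[K] CoordRing ι K :=
  evalPair (const g * genX ι K * const h)
    (const ((h⁻¹ : GL ι K) : Matrix ι ι K) * genY ι K * const ((g⁻¹ : GL ι K) : Matrix ι ι K))

lemma ev_trans (g h u : GL ι K) (F : CoordRing ι K) :
    ev u (trans g h F) = ev (g * u * h) F := by
  suffices (ev u).comp (trans g h) = ev (g * u * h) from DFunLike.congr_fun this F
  apply algHom_ext_gen
  · rw [AlgHom.coe_comp, ← Matrix.map_map, trans, map_evalPair_genX]
    simp [Matrix.map_mul]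
  · rw [AlgHom.coe_comp, ← Matrix.map_map, trans, map_evalPair_genY]
    simp [Matrix.map_mul, mul_assoc]

/-- The substitution `u ↦ u⁻¹` on coordinate polynomials. -/
noncomputable def invSubst : CoordRing ι K →ₐ[K] CoordRing ι K :=
  evalPair (genY ι K) (genX ι K)

lemma ev_invSubst (u : GL ι K) (F : CoordRing ι K) : ev u (invSubst F) = ev u⁻¹ F := by
  suffices (ev u).comp invSubst = ev u⁻¹ from DFunLike.congr_fun this F
  apply algHom_ext_gen <;> rw [AlgHom.coe_comp, ← Matrix.map_map, invSubst] <;> simp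

/-- The left-invariant derivation attached to a matrix. -/
noncomputable def leftDer (A : Matrix ι ι K) : Derivation K (CoordRing ι K) (CoordRing ι K) :=
  mkDerivation K (Sum.elim (fun p => (genX ι K * const A) p.1 p.2)
    (fun p => (-(const A * genY ι K)) p.1 p.2))

@[simp] lemma map_leftDer_genX (A : Matrix ι ι K) :
    (genX ι K).map (leftDer A) = genX ι K * const A := by
  refine Matrix.ext fun i j => ?_
  exact mkDerivation_X K _ _

@[simp] lemma map_leftDer_genY (A : Matrix ι ι K) :
    (genY ι K).map (leftDer A) = -(const A * genY ι K) := by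
  refine Matrix.ext fun i j => ?_
  exact mkDerivation_X K _ _

lemma map_derivation_mul (D : Derivation K (CoordRing ι K) (CoordRing ι K))
    (A B : Matrix ι ι (CoordRing ι K)) : (A * B).map D = A.map D * B + A * B.map D := by
  refine Matrix.ext fun i j => ?_
  simp [Matrix.mul_apply, ← Finset.sum_add_distrib, mul_comm, add_comm]

@[simp] lemma map_derivation_const (D : Derivation K (CoordRing ι K) (CoordRing ι K))
    (A : Matrix ι ι K) : (const A).map D = 0 := by
  refine Matrix.ext fun i j => ?_
  exact D.map_algebraMap (A i j)

lemma derivation_ext_gen {D E : Derivation K (CoordRing ι K) (CoordRing ι K)}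
    (hX : (genX ι K).map D = (genX ι K).map E) (hY : (genY ι K).map D = (genY ι K).map E) :
    D = E := by
  refine MvPolynomial.derivation_ext fun s => ?_
  rcases s with ⟨i, j⟩ | ⟨i, j⟩
  · exact congrFun (congrFun hX i) j
  · exact congrFun (congrFun hY i) j

/-- `leftDer` as a linear map. -/
noncomputable def leftDerₗ :
    Matrix ι ι K →ₗ[K] Derivation K (CoordRing ι K) (CoordRing ι K) where
  toFun := leftDer
  map_add' A B := by
    apply derivation_ext_gen
    · trans (genX ι K).map (leftDer A) + (genX ι K).map (leftDer B)
      · simp only [map_leftDer_genX, ← mul_add]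
        congr 1
        refine Matrix.ext fun i j => ?_
        simp [const]
      · rfl
    · trans (genY ι K).map (leftDer A) + (genY ι K).map (leftDer B)
      · simp only [map_leftDer_genY, ← neg_add, ← add_mul]
        congr 2
        refine Matrix.ext fun i j => ?_
        simp [const]
      · rfl
  map_smul' c A := by
    apply derivation_ext_gen
    · trans c • (genX ι K).map (leftDer A)
      · simp only [map_leftDer_genX, ← mul_smul_comm]
        congr 1
        refine Matrix.ext fun i j => ?_
        simp [const, smul_eq_C_mul]
      · rfl
    · trans c • (genY ι K).map (leftDer A)
      · rw [map_leftDer_genY, map_leftDer_genY, smul_neg, ← smul_mul_assoc]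
        congr 2
        refine Matrix.ext fun i j => ?_
        simp [const, smul_eq_C_mul]
      · rfl

@[simp] lemma leftDerₗ_apply (A : Matrix ι ι K) (F : CoordRing ι K) :
    leftDerₗ A F = leftDer A F := rfl

lemma leftDer_lie (A B : Matrix ι ι K) : leftDer ⁅A, B⁆ = ⁅leftDer A, leftDer B⁆ := by
  have key (Z : Matrix ι ι (CoordRing ι K)) :
      Z.map (⁅leftDer A, leftDer B⁆ : Derivation K (CoordRing ι K) (CoordRing ι K)) =
      (Z.map (leftDer B)).map (leftDer A) - (Z.map (leftDer A)).map (leftDer B) := by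
    refine Matrix.ext fun i j => ?_
    simp [Derivation.commutator_apply]
  have hsub : const ⁅A, B⁆ = const A * const B - const B * const A := by
    rw [← const_mul, ← const_mul, Ring.lie_def]
    exact Matrix.map_sub _ (map_sub _) _ _
  have hneg (D : Derivation K (CoordRing ι K) (CoordRing ι K))
      (Z : Matrix ι ι (CoordRing ι K)) : (-Z).map D = -Z.map D := by
    refine Matrix.ext fun i j => ?_
    simp
  apply derivation_ext_gen
  · rw [key]
    simp [map_derivation_mul, hsub, mul_assoc, mul_sub]
  · rw [key]
    simp [map_derivation_mul, hsub, hneg, mul_assoc, sub_mul]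

lemma leftDer_trans (g h : GL ι K) (A : Matrix ι ι K) (F : CoordRing ι K) :
    leftDer A (trans g h F) =
      trans g h (leftDer (((h⁻¹ : GL ι K) : Matrix ι ι K) * A * (h : Matrix ι ι K)) F) := by
  set B := ((h⁻¹ : GL ι K) : Matrix ι ι K) * A * (h : Matrix ι ι K) with hB
  have hX : ((genX ι K).map (trans g h)).map (leftDer A) =
      ((genX ι K).map (leftDer B)).map (trans g h) := by
    have : const (h : Matrix ι ι K) * const B = const A * const h := by
      rw [← const_mul, ← const_mul, hB]
      simp [← mul_assoc]
    rw [trans]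
    simp only [map_evalPair_genX, map_leftDer_genX, map_derivation_mul, map_derivation_const,
      Matrix.map_mul, map_const, mul_assoc, this]
    simp
  have hY : ((genY ι K).map (trans g h)).map (leftDer A) =
      ((genY ι K).map (leftDer B)).map (trans g h) := by
    have : const B * const ((h⁻¹ : GL ι K) : Matrix ι ι K) =
        const ((h⁻¹ : GL ι K) : Matrix ι ι K) * const A := by
      rw [← const_mul, ← const_mul, hB]
      simp [mul_assoc]
    have hneg (Z : Matrix ι ι (CoordRing ι K)) :
        (-Z).map (trans g h) = -Z.map (trans g h) := by
      refine Matrix.ext fun i j => ?_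
      simp
    rw [map_leftDer_genY, hneg, trans]
    simp only [map_evalPair_genY, map_leftDer_genY, map_derivation_mul, map_derivation_const,
      Matrix.map_mul, map_const, ← mul_assoc, this]
    simp [mul_assoc]
  induction F using MvPolynomial.induction_on with
  | C c =>
    have h1 : trans g h (C c) = C c := (trans g h).commutes c
    rw [h1]
    simp
  | add p q hp hq => simp [hp, hq]
  | mul_X p s hp =>
    have hs : leftDer A (trans g h (X s)) = trans g h (leftDer B (X s)) := by
      rcases s with ⟨i, j⟩ | ⟨i, j⟩
      · exact congrFun (congrFun hX i) j
      · exact congrFun (congrFun hY i) j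
    simp [hp, hs]

/-- The polynomial obtained by applying a linear functional to a matrix of polynomials. -/
noncomputable def pair (φ : Module.Dual K (Matrix ι ι K)) (Z : Matrix ι ι (CoordRing ι K)) :
    CoordRing ι K :=
  ∑ i, ∑ j, φ (Matrix.single i j 1) • Z i j

lemma map_pair_scalar (θ : CoordRing ι K →ₗ[K] K) (φ : Module.Dual K (Matrix ι ι K))
    (Z : Matrix ι ι (CoordRing ι K)) : θ (pair φ Z) = φ (Z.map θ) := by
  conv_rhs => rw [Matrix.matrix_eq_sum_single (Z.map θ)]
  simp only [pair, map_sum, map_smul, Matrix.map_apply, smul_eq_mul]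
  refine Finset.sum_congr rfl fun i _ => Finset.sum_congr rfl fun j _ => ?_
  have : Matrix.single i j (θ (Z i j)) = θ (Z i j) • Matrix.single i j (1 : K) := by
    simp [Matrix.smul_single]
  rw [this, map_smul, smul_eq_mul, mul_comm]

lemma map_pair (D : CoordRing ι K →ₗ[K] CoordRing ι K) (φ : Module.Dual K (Matrix ι ι K))
    (Z : Matrix ι ι (CoordRing ι K)) : D (pair φ Z) = pair φ (Z.map D) := by
  simp [pair]

lemma ev_pair (g : GL ι K) (φ : Module.Dual K (Matrix ι ι K))
    (Z : Matrix ι ι (CoordRing ι K)) : ev g (pair φ Z) = φ (Z.map (ev g)) :=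
  map_pair_scalar (ev g).toLinearMap φ Z

lemma leftDer_pair (A : Matrix ι ι K) (φ : Module.Dual K (Matrix ι ι K))
    (Z : Matrix ι ι (CoordRing ι K)) : leftDer A (pair φ Z) = pair φ (Z.map (leftDer A)) :=
  map_pair (leftDer A).toLinearMap φ Z

/-- The ideal of coordinate polynomials vanishing on a set of invertible matrices. -/
noncomputable def vanishing (M : Set (GL ι K)) : Ideal (CoordRing ι K) :=
  ⨅ g ∈ M, RingHom.ker (ev g)

lemma mem_vanishing {M : Set (GL ι K)} {F : CoordRing ι K} :
    F ∈ vanishing M ↔ ∀ g ∈ M, ev g F = 0 := by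
  simp [vanishing, Submodule.mem_iInf]

/-- A set of invertible matrices is algebraic if it is cut out by coordinate polynomials. -/
def IsAlgebraicSet (M : Set (GL ι K)) : Prop :=
  ∃ T : Set (CoordRing ι K), M = {g | ∀ F ∈ T, ev g F = 0}

lemma IsAlgebraicSet.mem {M : Set (GL ι K)} (hM : IsAlgebraicSet M) {g : GL ι K}
    (hg : ∀ F ∈ vanishing M, ev g F = 0) : g ∈ M := by
  obtain ⟨T, rfl⟩ := hM
  exact fun F hF => hg F (mem_vanishing.mpr fun u hu => hu F hF)

lemma vanishing_trans {M : Subgroup (GL ι K)} {g : GL ι K} (hg : g ∈ M)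
    {F : CoordRing ι K} (hF : F ∈ vanishing (M : Set (GL ι K))) :
    trans g 1 F ∈ vanishing (M : Set (GL ι K)) := by
  rw [mem_vanishing] at hF ⊢
  intro u hu
  rw [ev_trans, mul_one]
  exact hF _ (M.mul_mem hg hu)

/-- The derivative at the identity of a coordinate polynomial. -/
noncomputable def diffOne : CoordRing ι K →ₗ[K] Module.Dual K (Matrix ι ι K) where
  toFun F :=
    { toFun := fun A => ev 1 (leftDer A F)
      map_add' := fun A B => by simp [← leftDerₗ_apply]
      map_smul' := fun c A => by simp [← leftDerₗ_apply] }
  map_add' F G := by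
    ext A
    exact (congrArg (ev 1) (map_add (leftDer A) F G)).trans (map_add _ _ _)
  map_smul' c F := by
    ext A
    exact (congrArg (ev 1) ((leftDer A).map_smul c F)).trans (map_smul _ _ _)

@[simp] lemma diffOne_apply (F : CoordRing ι K) (A : Matrix ι ι K) :
    diffOne F A = ev 1 (leftDer A F) := rfl

lemma ev_leftDer (g : GL ι K) (A : Matrix ι ι K) (F : CoordRing ι K) :
    ev g (leftDer A F) = ev 1 (leftDer A (trans g 1 F)) := by
  rw [leftDer_trans, ev_trans]
  simp

/-- The space of tangent matrices at the identity of a set of invertible matrices. -/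
noncomputable def tangent (M : Set (GL ι K)) : Submodule K (Matrix ι ι K) :=
  ((vanishing M).restrictScalars K |>.map diffOne).dualCoannihilator

lemma mem_tangent {M : Set (GL ι K)} {A : Matrix ι ι K} :
    A ∈ tangent M ↔ ∀ F ∈ vanishing M, ev 1 (leftDer A F) = 0 := by
  simp [tangent, Submodule.mem_dualCoannihilator]

lemma leftDer_mem_vanishing {M : Subgroup (GL ι K)} {A : Matrix ι ι K}
    (hA : A ∈ tangent (M : Set (GL ι K))) {F : CoordRing ι K}
    (hF : F ∈ vanishing (M : Set (GL ι K))) :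
    leftDer A F ∈ vanishing (M : Set (GL ι K)) := by
  rw [mem_vanishing]
  intro g hg
  rw [ev_leftDer]
  exact mem_tangent.mp hA _ (vanishing_trans hg hF)

lemma lie_mem_tangent {M : Subgroup (GL ι K)} {A B : Matrix ι ι K}
    (hA : A ∈ tangent (M : Set (GL ι K))) (hB : B ∈ tangent (M : Set (GL ι K))) :
    ⁅A, B⁆ ∈ tangent (M : Set (GL ι K)) := by
  rw [mem_tangent]
  intro F hF
  rw [leftDer_lie, Derivation.commutator_apply, map_sub,
    mem_tangent.mp hA _ (leftDer_mem_vanishing hB hF),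
    mem_tangent.mp hB _ (leftDer_mem_vanishing hA hF), sub_zero]

/-- The maximal ideal of the identity matrix. -/
noncomputable def maxOne (ι K : Type*) [Fintype ι] [DecidableEq ι] [Field K] :
    Ideal (CoordRing ι K) :=
  RingHom.ker (ev (1 : GL ι K))

lemma mem_maxOne {F : CoordRing ι K} : F ∈ maxOne ι K ↔ ev 1 F = 0 := Iff.rfl

/-- The largest ideal of polynomials vanishing at the identity that is stable under the
left-invariant derivations attached to `L`. -/
noncomputable def flatIdeal (L : Submodule K (Matrix ι ι K)) : Ideal (CoordRing ι K) :=
  sSup {I | I ≤ maxOne ι K ∧ ∀ A ∈ L, ∀ F ∈ I, leftDer A F ∈ I}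

lemma le_flatIdeal {L : Submodule K (Matrix ι ι K)} {I : Ideal (CoordRing ι K)}
    (h₁ : I ≤ maxOne ι K) (h₂ : ∀ A ∈ L, ∀ F ∈ I, leftDer A F ∈ I) : I ≤ flatIdeal L :=
  le_sSup ⟨h₁, h₂⟩

lemma flatIdeal_le (L : Submodule K (Matrix ι ι K)) : flatIdeal L ≤ maxOne ι K :=
  sSup_le fun _ h => h.1

lemma leftDer_mem_flatIdeal {L : Submodule K (Matrix ι ι K)} {A : Matrix ι ι K} (hA : A ∈ L)
    {F : CoordRing ι K} (hF : F ∈ flatIdeal L) : leftDer A F ∈ flatIdeal L := by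
  rw [flatIdeal, sSup_eq_iSup'] at hF
  induction hF using Submodule.iSup_induction' with
  | mem I F hF => exact le_flatIdeal I.2.1 I.2.2 (I.2.2 A hA F hF)
  | zero => simp
  | add F G _ _ hF hG => simpa using add_mem hF hG

lemma vanishing_le_flatIdeal (M : Subgroup (GL ι K)) :
    vanishing (M : Set (GL ι K)) ≤ flatIdeal (tangent (M : Set (GL ι K))) :=
  le_flatIdeal (fun _ hF => mem_vanishing.mp hF 1 M.one_mem)
    fun _ hA _ hF => leftDer_mem_vanishing hA hF

lemma trans_mem_flatIdeal {L : Submodule K (Matrix ι ι K)} {g : GL ι K}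
    (hg : ∀ F ∈ flatIdeal L, ev g F = 0) {F : CoordRing ι K} (hF : F ∈ flatIdeal L) :
    trans g 1 F ∈ flatIdeal L := by
  have hle : (flatIdeal L).map (trans g 1) ≤ flatIdeal L := by
    apply le_flatIdeal
    · rw [Ideal.map_le_iff_le_comap]
      intro G hG
      rw [Ideal.mem_comap, mem_maxOne, ev_trans]
      simpa using hg G hG
    · intro A hA G hG
      induction hG using Submodule.span_induction with
      | mem x hx =>
        obtain ⟨G, hG, rfl⟩ := hx
        have := leftDer_trans g 1 A G
        simp only [inv_one, Units.val_one, one_mul, mul_one] at this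
        change leftDer A (trans g 1 G) ∈ _
        rw [this]
        exact Ideal.mem_map_of_mem _ (leftDer_mem_flatIdeal hA hG)
      | zero => simp
      | add x y _ _ hx hy => simpa using add_mem hx hy
      | smul a x hx' hx =>
        rw [smul_eq_mul, Derivation.leibniz]
        exact add_mem (Ideal.mul_mem_left _ _ hx) (Ideal.mul_mem_right _ _ hx')
  exact hle (Ideal.mem_map_of_mem _ hF)

/-- The group of common zeros of `flatIdeal L`: the connected group with tangent space `L`,
whenever there is one. -/
noncomputable def flatGroup (L : Submodule K (Matrix ι ι K)) : Subgroup (GL ι K) where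
  carrier := {g | ∀ F ∈ flatIdeal L, ev g F = 0 ∧ ev g⁻¹ F = 0}
  one_mem' F hF := by simpa using mem_maxOne.mp (flatIdeal_le L hF)
  mul_mem' {g h} hg hh F hF := by
    constructor
    · have := (hh _ (trans_mem_flatIdeal (fun F hF => (hg F hF).1) hF)).1
      simpa [ev_trans] using this
    · have := (hg _ (trans_mem_flatIdeal (fun F hF => (hh F hF).2) hF)).2
      simpa [ev_trans] using this
  inv_mem' {g} hg F hF := by simpa using (hg F hF).symm

lemma mem_flatGroup {L : Submodule K (Matrix ι ι K)} {g : GL ι K} :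
    g ∈ flatGroup L ↔ ∀ F ∈ flatIdeal L, ev g F = 0 ∧ ev g⁻¹ F = 0 := Iff.rfl

lemma isAlgebraicSet_flatGroup (L : Submodule K (Matrix ι ι K)) :
    IsAlgebraicSet (flatGroup L : Set (GL ι K)) := by
  refine ⟨flatIdeal L ∪ invSubst '' (flatIdeal L), ?_⟩
  ext g
  simp only [SetLike.mem_coe, mem_flatGroup, Set.mem_union, Set.mem_ofPred_eq]
  constructor
  · rintro h F (hF | ⟨F, hF, rfl⟩)
    · exact (h F hF).1
    · rw [ev_invSubst]
      exact (h F hF).2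
  · exact fun h F hF => ⟨h F (.inl hF), by rw [← ev_invSubst]; exact h _ (.inr ⟨F, hF, rfl⟩)⟩

lemma flatGroup_tangent_le {M : Subgroup (GL ι K)} (hM : IsAlgebraicSet (M : Set (GL ι K))) :
    flatGroup (tangent (M : Set (GL ι K))) ≤ M :=
  fun _ hg => hM.mem fun F hF => (hg F (vanishing_le_flatIdeal M hF)).1

lemma sub_one_mem_maxOne (i j : ι) : (genX ι K - 1) i j ∈ maxOne ι K := by
  have : ((genX ι K - 1).map (ev 1)) i j = 0 := by
    rw [Matrix.map_sub _ (map_sub _), Matrix.map_one _ (map_zero _) (map_one _), map_ev_genX]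
    simp
  exact this

lemma genY_sub_one_mem_maxOne (i j : ι) : (genY ι K - 1) i j ∈ maxOne ι K := by
  have : ((genY ι K - 1).map (ev 1)) i j = 0 := by
    rw [Matrix.map_sub _ (map_sub _), Matrix.map_one _ (map_zero _) (map_one _), map_ev_genY]
    simp
  exact this

lemma pair_sub_one_mem_maxOne (φ : Module.Dual K (Matrix ι ι K)) :
    pair φ (genX ι K - 1) ∈ maxOne ι K := by
  rw [mem_maxOne, ev_pair, Matrix.map_sub _ (map_sub _),
    Matrix.map_one _ (map_zero _) (map_one _), map_ev_genX]
  simp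

lemma pair_add (φ ψ : Module.Dual K (Matrix ι ι K)) (Z : Matrix ι ι (CoordRing ι K)) :
    pair (φ + ψ) Z = pair φ Z + pair ψ Z := by
  simp [pair, add_smul, Finset.sum_add_distrib]

lemma pair_smul (c : K) (φ : Module.Dual K (Matrix ι ι K)) (Z : Matrix ι ι (CoordRing ι K)) :
    pair (c • φ) Z = c • pair φ Z := by
  simp [pair, Finset.smul_sum, mul_smul]

lemma pair_entry (φ : Module.Dual K (Matrix ι ι K)) (i j : ι) (hφ : ∀ A, φ A = A i j)
    (Z : Matrix ι ι (CoordRing ι K)) : pair φ Z = Z i j := by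
  simp only [pair, hφ, Matrix.single_apply, ite_and]
  simp [ite_smul]

/-- First-order Taylor expansion at the identity. -/
lemma taylor (M : Set (GL ι K)) (F : CoordRing ι K) :
    F - C (ev 1 F) - pair (diffOne F) (genX ι K - 1) ∈ maxOne ι K ^ 2 ⊔ vanishing M := by
  induction F using MvPolynomial.induction_on with
  | C c =>
    have h1 : ev (1 : GL ι K) (C c) = c := (ev 1).commutes c
    have h2 : diffOne (C c : CoordRing ι K) = 0 := by ext; simp
    simp [h1, h2, pair]
  | add p q hp hq =>
    convert add_mem hp hq using 1
    simp only [map_add, pair_add]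
    ring
  | mul_X p s hp =>
    have hs : X s - C (ev 1 (X s)) - pair (diffOne (X s)) (genX ι K - 1) ∈
        maxOne ι K ^ 2 ⊔ vanishing M := by
      rcases s with ⟨i, j⟩ | ⟨i, j⟩
      · have h1 : ev (1 : GL ι K) (X (Sum.inl (i, j))) = (1 : Matrix ι ι K) i j :=
          congrFun (congrFun (map_ev_genX (1 : GL ι K)) i) j
        have h2 (A : Matrix ι ι K) : diffOne (X (Sum.inl (i, j))) A = A i j := by
          have := congrFun (congrFun (map_leftDer_genX A) i) j
          have h3 := congrArg (ev 1) this
          have h4 : ((genX ι K * const A).map (ev 1)) i j = A i j := by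
            rw [Matrix.map_mul]
            simp
          exact h3.trans h4
        rw [pair_entry _ i j h2, h1]
        have h3 : X (Sum.inl (i, j)) - C ((1 : Matrix ι ι K) i j) - (genX ι K - 1) i j = 0 := by
          change genX ι K i j - const 1 i j - _ = _
          simp
        rw [h3]
        exact zero_mem _
      · have h1 : ev (1 : GL ι K) (X (Sum.inr (i, j))) = (1 : Matrix ι ι K) i j := by
          have := congrFun (congrFun (map_ev_genY (1 : GL ι K)) i) j
          rwa [inv_one] at this
        have h2 (A : Matrix ι ι K) : (-diffOne (X (Sum.inr (i, j)))) A = A i j := by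
          have := congrFun (congrFun (map_leftDer_genY A) i) j
          have h3 := congrArg (ev 1) this
          have h4 : ((-(const A * genY ι K)).map (ev 1)) i j = -A i j := by
            rw [Matrix.map_neg _ (map_neg _)]
            simp [Matrix.map_mul]
          have h5 := h3.trans h4
          rw [LinearMap.neg_apply, neg_eq_iff_eq_neg]
          exact h5
        rw [← neg_neg (diffOne (X (Sum.inr (i, j)))), ← neg_one_smul K (-diffOne _), pair_smul,
          pair_entry _ i j h2, h1]
        have h6 : X (Sum.inr (i, j)) - C ((1 : Matrix ι ι K) i j) -
            (-1 : K) • (genX ι K - 1) i j =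
            (genX ι K * genY ι K - 1) i j - ((genX ι K - 1) * (genY ι K - 1)) i j := by
          have h7 : (genX ι K * genY ι K - 1) - ((genX ι K - 1) * (genY ι K - 1)) =
              (genY ι K - const 1) + (genX ι K - 1) := by
            rw [const_one]
            noncomm_ring
          have h8 := congrFun (congrFun h7 i) j
          rw [Matrix.sub_apply] at h8
          rw [h8, neg_one_smul, sub_neg_eq_add]
          rfl
        rw [h6]
        refine sub_mem (Ideal.mem_sup_right ?_) (Ideal.mem_sup_left ?_)
        · rw [mem_vanishing]
          intro g _
          have : ((genX ι K * genY ι K - 1).map (ev g)) i j = 0 := by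
            rw [Matrix.map_sub _ (map_sub _), Matrix.map_one _ (map_zero _) (map_one _),
              Matrix.map_mul]
            simp
          exact this
        · rw [Matrix.mul_apply, pow_two]
          exact sum_mem fun k _ =>
            Ideal.mul_mem_mul (sub_one_mem_maxOne i k) (genY_sub_one_mem_maxOne k j)
    have hd : diffOne (p * X s) = ev 1 p • diffOne (X s) +
        ev 1 (X s : CoordRing ι K) • diffOne p := by
      ext A
      simp
    have hC (a : K) (F : CoordRing ι K) : a • F = C a * F := MvPolynomial.smul_eq_C_mul _ _
    set lp := pair (diffOne p) (genX ι K - 1)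
    set ls := pair (diffOne (X s)) (genX ι K - 1)
    have hl : lp * ls ∈ maxOne ι K ^ 2 ⊔ vanishing M := by
      rw [pow_two]
      exact Ideal.mem_sup_left
        (Ideal.mul_mem_mul (pair_sub_one_mem_maxOne _) (pair_sub_one_mem_maxOne _))
    have key := add_mem (add_mem (Ideal.mul_mem_right (X s) _ hp)
      (Ideal.mul_mem_left _ (C (ev 1 p) + lp) hs)) hl
    convert key using 1
    rw [hd, pair_add, pair_smul, pair_smul, hC, hC, map_mul, C_mul]
    ring

lemma _root_.Ideal.mul_sup_le {R : Type*} [CommRing R] (I J I' : Ideal R) :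
    I * (J ⊔ I') ≤ I * J ⊔ I' := by
  rw [Ideal.mul_sup]
  exact sup_le_sup le_rfl Ideal.mul_le_right

lemma pair_mem_of_forall_tangent {M : Subgroup (GL ι K)} {ψ : Module.Dual K (Matrix ι ι K)}
    (hψ : ∀ A ∈ tangent (M : Set (GL ι K)), ψ A = 0) :
    pair ψ (genX ι K - 1) ∈ maxOne ι K ^ 2 ⊔ vanishing (M : Set (GL ι K)) := by
  have h : ψ ∈ (tangent (M : Set (GL ι K))).dualAnnihilator :=
    (Submodule.mem_dualAnnihilator ψ).mpr hψ
  rw [tangent, Subspace.dualCoannihilator_dualAnnihilator_eq] at h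
  obtain ⟨F, hF, rfl⟩ := h
  have hF' : F ∈ vanishing (M : Set (GL ι K)) := hF
  have h := taylor (M : Set (GL ι K)) F
  rw [mem_vanishing.mp hF' 1 M.one_mem, map_zero, sub_zero] at h
  simpa using sub_mem (Ideal.mem_sup_right hF') h

/-- An Euler-type vector field: it acts as the identity on the cotangent space. -/
lemma exists_euler (M : Subgroup (GL ι K)) :
    ∃ E : Derivation K (CoordRing ι K) (CoordRing ι K),
      (∀ I J : Ideal (CoordRing ι K), (∀ A ∈ tangent (M : Set (GL ι K)), ∀ F ∈ I,
        leftDer A F ∈ J) → ∀ F ∈ I, E F ∈ maxOne ι K * J) ∧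
      ∀ v ∈ maxOne ι K, E v - v ∈ maxOne ι K ^ 2 ⊔ vanishing (M : Set (GL ι K)) := by
  set L := tangent (M : Set (GL ι K))
  let b := Module.finBasis K L
  obtain ⟨pr, hpr⟩ := L.subtype.exists_leftInverse_of_injective L.ker_subtype
  let φ (i) : Module.Dual K (Matrix ι ι K) := b.coord i ∘ₗ pr
  let u (i) : CoordRing ι K := pair (φ i) (genX ι K - 1)
  have hu (i) : u i ∈ maxOne ι K := pair_sub_one_mem_maxOne _
  have hE (F : CoordRing ι K) :
      (∑ i, u i • leftDer (b i : Matrix ι ι K)) F = ∑ i, u i * leftDer (b i : Matrix ι ι K) F := by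
    have := map_sum (Derivation.coeFnAddMonoidHom (R := K) (A := CoordRing ι K)
      (M := CoordRing ι K)) (fun i => u i • leftDer (b i : Matrix ι ι K)) Finset.univ
    refine (congrFun this F).trans ?_
    rw [Finset.sum_apply]
    rfl
  refine ⟨∑ i, u i • leftDer (b i : Matrix ι ι K), fun I J h F hF => ?_, fun v hv => ?_⟩
  · rw [hE]
    exact sum_mem fun i _ => Ideal.mul_mem_mul (hu i) (h _ (b i).2 F hF)
  · let ψ : Module.Dual K (Matrix ι ι K) := diffOne v - ∑ i, diffOne v (b i) • φ i
    have hψ : ∀ A ∈ L, ψ A = 0 := by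
      intro A hA
      have h1 : pr A = ⟨A, hA⟩ := LinearMap.congr_fun hpr ⟨A, hA⟩
      have h2 : A = ∑ i, φ i A • (b i : Matrix ι ι K) := by
        have h3 := congrArg L.subtype (b.sum_repr ⟨A, hA⟩)
        simp only [map_sum, map_smul, Submodule.subtype_apply] at h3
        simp only [φ, LinearMap.comp_apply, h1, Module.Basis.coord_apply]
        exact h3.symm
      have h4 : diffOne v A = ∑ i, φ i A * diffOne v (b i) := by
        conv_lhs => rw [h2]
        simp only [map_sum, map_smul, smul_eq_mul]
      simp only [ψ, LinearMap.sub_apply, LinearMap.sum_apply, LinearMap.smul_apply, h4,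
        smul_eq_mul, mul_comm, sub_self]
    have h1 := pair_mem_of_forall_tangent hψ
    have h2 := taylor (M : Set (GL ι K)) v
    rw [mem_maxOne.mp hv, map_zero, sub_zero] at h2
    have h3 : ∑ i, u i * (leftDer (b i : Matrix ι ι K) v - C (diffOne v (b i))) ∈
        maxOne ι K ^ 2 ⊔ vanishing (M : Set (GL ι K)) := by
      refine Ideal.mem_sup_left (sum_mem fun i _ => ?_)
      rw [pow_two]
      refine Ideal.mul_mem_mul (hu i) ?_
      rw [mem_maxOne, map_sub, diffOne_apply, sub_eq_zero]
      exact ((ev 1).commutes _).symm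
    have h4 : pair (diffOne v) (genX ι K - 1) =
        pair ψ (genX ι K - 1) + ∑ i, u i * C (diffOne v (b i)) := by
      have hsum : diffOne v = ψ + ∑ i, diffOne v (b i) • φ i := by simp [ψ]
      have hlin : pair (∑ i, diffOne v (b i) • φ i) (genX ι K - 1) =
          ∑ i, u i * C (diffOne v (b i)) := by
        let P : Module.Dual K (Matrix ι ι K) →ₗ[K] CoordRing ι K :=
          { toFun := fun φ => pair φ (genX ι K - 1)
            map_add' := fun _ _ => pair_add _ _ _
            map_smul' := fun _ _ => pair_smul _ _ _ }
        have := map_sum P (fun i => diffOne v (b i) • φ i) Finset.univ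
        refine this.trans (Finset.sum_congr rfl fun i _ => ?_)
        rw [map_smul, MvPolynomial.smul_eq_C_mul, mul_comm]
        rfl
      conv_lhs => rw [hsum]
      rw [pair_add, hlin]
    have h5 := sub_mem (sub_mem h3 h1) h2
    convert h5 using 1
    rw [hE, h4]
    simp only [mul_sub, Finset.sum_sub_distrib]
    ring

lemma flatIdeal_le_pow_sup [CharZero K] (M : Subgroup (GL ι K)) (k : ℕ) :
    flatIdeal (tangent (M : Set (GL ι K))) ≤ maxOne ι K ^ k ⊔ vanishing (M : Set (GL ι K)) := by
  obtain ⟨E, hE, hEm⟩ := exists_euler M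
  set m := maxOne ι K
  set I := vanishing (M : Set (GL ι K))
  have hpow (k : ℕ) : ∀ F ∈ m ^ k, E F - k • F ∈ m ^ (k + 1) ⊔ I := by
    induction k with
    | zero =>
      intro F _
      have h := hE ⊤ ⊤ (fun _ _ _ _ => trivial) F trivial
      rw [Ideal.mul_top] at h
      simpa using Ideal.mem_sup_left (T := I) h
    | succ k ih =>
      intro F hF
      rw [pow_succ] at hF
      induction hF using Submodule.mul_induction_on' with
      | mem_mul_mem a ha v hv =>
        have h1 : a * (E v - v) ∈ m ^ (k + 1 + 1) ⊔ I := by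
          have : a * (E v - v) ∈ m ^ k * (m ^ 2 ⊔ I) := Ideal.mul_mem_mul ha (hEm v hv)
          replace this := Ideal.mul_sup_le _ _ _ this
          rwa [← pow_add] at this
        have h2 : v * (E a - k • a) ∈ m ^ (k + 1 + 1) ⊔ I := by
          have : v * (E a - k • a) ∈ m * (m ^ (k + 1) ⊔ I) := Ideal.mul_mem_mul hv (ih a ha)
          replace this := Ideal.mul_sup_le _ _ _ this
          rwa [← pow_succ'] at this
        convert add_mem h1 h2 using 1
        rw [Derivation.leibniz]
        simp only [smul_eq_mul, nsmul_eq_mul]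
        push_cast
        ring
      | add F _ G _ hF hG =>
        convert add_mem hF hG using 1
        rw [map_add, smul_add]
        ring
  induction k with
  | zero => simp
  | succ k ih =>
    rcases Nat.eq_zero_or_pos k with rfl | hk
    · simpa using (flatIdeal_le _).trans le_sup_left
    intro F hF
    have hEF : E F ∈ m ^ (k + 1) ⊔ I := by
      have := hE _ _ (fun A hA F hF => ih (leftDer_mem_flatIdeal hA hF)) F hF
      replace this := Ideal.mul_sup_le _ _ _ this
      rwa [← pow_succ'] at this
    obtain ⟨f, hf, i, hi, rfl⟩ := Submodule.mem_sup.mp (ih hF)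
    have hEi : E i ∈ I :=
      (Ideal.mul_le_right : maxOne ι K * I ≤ I)
        (hE I I (fun A hA F hF => leftDer_mem_vanishing hA hF) i hi)
    have hkf : k • f ∈ m ^ (k + 1) ⊔ I := by
      rw [map_add] at hEF
      have := sub_mem (sub_mem hEF (Ideal.mem_sup_right hEi)) (hpow k f hf)
      convert this using 1
      ring
    have hf' : f ∈ m ^ (k + 1) ⊔ I := by
      have hk0 : (k : K) ≠ 0 := by exact_mod_cast hk.ne'
      have := Ideal.mul_mem_left _ (C (k : K)⁻¹) hkf
      rwa [nsmul_eq_mul, ← mul_assoc, ← map_natCast (C : K →+* CoordRing ι K), ← C_mul,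
        inv_mul_cancel₀ hk0, C_1, one_mul] at this
    exact add_mem hf' (Ideal.mem_sup_right hi)

lemma exists_mul_mem_vanishing [CharZero K] (M : Subgroup (GL ι K)) :
    ∃ s : CoordRing ι K, ev 1 s = 1 ∧ ∀ F ∈ flatIdeal (tangent (M : Set (GL ι K))),
      s * F ∈ vanishing (M : Set (GL ι K)) := by
  set I := vanishing (M : Set (GL ι K))
  set m := maxOne ι K
  let N : Submodule (CoordRing ι K) (CoordRing ι K ⧸ I) := ⨅ i : ℕ, m ^ i • ⊤
  have hN : N ≤ m • N := by
    intro x hx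
    obtain ⟨r, hr⟩ := (Ideal.mem_iInf_smul_pow_eq_bot_iff m x).mp hx
    rw [← hr]
    exact Submodule.smul_mem_smul r.2 hx
  obtain ⟨r, hr, hrN⟩ := Submodule.exists_mem_and_smul_eq_self_of_fg_of_le_smul m N
    (IsNoetherian.noetherian N) hN
  refine ⟨1 - r, by rw [map_sub, map_one, mem_maxOne.mp hr, sub_zero], fun F hF => ?_⟩
  have hFN : (Ideal.Quotient.mk I F : CoordRing ι K ⧸ I) ∈ N := by
    refine Submodule.mem_iInf _ |>.mpr fun k => ?_
    obtain ⟨f, hf, i, hi, rfl⟩ := Submodule.mem_sup.mp (flatIdeal_le_pow_sup M k hF)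
    rw [map_add, Ideal.Quotient.eq_zero_iff_mem.mpr hi, add_zero]
    have := Submodule.smul_mem_smul hf
      (Submodule.mem_top (x := (1 : CoordRing ι K ⧸ I)) (R := CoordRing ι K))
    have h1 : (f • 1 : CoordRing ι K ⧸ I) = Ideal.Quotient.mk I f :=
      (Algebra.algebraMap_eq_smul_one f).symm
    rwa [← h1]
  have := hrN _ hFN
  rw [← Ideal.Quotient.eq_zero_iff_mem, sub_mul, one_mul, map_sub, sub_eq_zero]
  exact this.symm

lemma finiteIndex_flatGroup [CharZero K] (M : Subgroup (GL ι K)) :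
    ((flatGroup (tangent (M : Set (GL ι K)))).subgroupOf M).FiniteIndex := by
  obtain ⟨s, hs1, hs⟩ := exists_mul_mem_vanishing M
  set S := flatGroup (tangent (M : Set (GL ι K)))
  set t := s * invSubst s
  have ht (g : GL ι K) (hg : g ∈ M) (h : ev g t ≠ 0) : g ∈ S := by
    rw [map_mul, ev_invSubst] at h
    intro F hF
    have h1 := mem_vanishing.mp (hs F hF) g hg
    have h2 := mem_vanishing.mp (hs F hF) g⁻¹ (M.inv_mem hg)
    rw [map_mul] at h1 h2
    exact ⟨(mul_eq_zero.mp h1).resolve_left (left_ne_zero_of_mul h),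
      (mul_eq_zero.mp h2).resolve_left (right_ne_zero_of_mul h)⟩
  have ht1 : ev 1 t = 1 := by
    rw [map_mul, ev_invSubst, inv_one, hs1, one_mul]
  obtain ⟨T, hT, hspan⟩ := (Submodule.fg_span_iff_fg_span_finset_subset
    (Set.range fun g : M => trans (g : GL ι K)⁻¹ 1 t)).mp
      (IsNoetherian.noetherian (Ideal.span (Set.range fun g : M => trans (g : GL ι K)⁻¹ 1 t)))
  choose! c hc using fun F (hF : F ∈ (T : Set (CoordRing ι K))) => hT hF
  have hcover (g : M) : ∃ F : T, (c F)⁻¹ * g ∈ S.subgroupOf M := by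
    by_contra! hcon
    have hzero : ∀ F ∈ T, ev (g : GL ι K) F = 0 := by
      intro F hF
      by_contra hne
      refine hcon ⟨F, hF⟩ (Subgroup.mem_subgroupOf.mpr
        (ht _ ((c F)⁻¹ * g).2 ?_))
      rw [← hc F hF, ev_trans, mul_one] at hne
      exact hne
    have hle : Ideal.span (T : Set (CoordRing ι K)) ≤ RingHom.ker (ev (g : GL ι K)) :=
      Ideal.span_le.mpr hzero
    have hmem : trans (g : GL ι K)⁻¹ 1 t ∈ Ideal.span (T : Set (CoordRing ι K)) := by
      change _ ∈ Submodule.span _ _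
      rw [← hspan]
      exact Submodule.subset_span ⟨g, rfl⟩
    have := hle hmem
    rw [RingHom.mem_ker, ev_trans] at this
    simp [ht1] at this
  have : Finite (M ⧸ S.subgroupOf M) := by
    refine Finite.of_surjective (fun F : T => (c F : M ⧸ S.subgroupOf M)) fun q => ?_
    induction q using QuotientGroup.induction_on with
    | H g =>
      obtain ⟨F, hF⟩ := hcover g
      exact ⟨F, QuotientGroup.eq.mpr hF⟩
  exact Subgroup.finiteIndex_of_finite_quotient

section Lie

open LieModule LieAlgebra

attribute [local instance] LieRing.ofAssociativeRing

lemma exists_lie_eq_smul_of_mem_radical {L P : Type*} [CharZero K] [IsAlgClosed K] [LieRing L]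
    [LieAlgebra K L] [Module.Finite K L] [AddCommGroup P] [Module K P] [Module.Finite K P]
    [LieRingModule L P] [LieModule K L P] [IsIrreducible K L P] {x : L} (hx : x ∈ radical K L) :
    ∃ c : K, ∀ m : P, ⁅x, m⁆ = c • m := by
  have _i := nontrivial_of_isIrreducible K L P
  obtain ⟨χ, hχ⟩ : ∃ χ : Module.Dual K (radical K L), Nontrivial (weightSpace P χ) :=
    exists_nontrivial_weightSpace_of_isSolvable K (radical K L) P
  let N : LieSubmodule K L P := weightSpaceOfIsLieTower K P χ
  replace hχ : Nontrivial N := hχ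
  replace hχ : N = ⊤ := N.eq_top_of_isIrreducible K L P
  refine ⟨χ ⟨x, hx⟩, fun m => ?_⟩
  have hm : ∀ (y : L) (hy : y ∈ radical K L), ⁅y, m⁆ = χ ⟨y, hy⟩ • m := by
    simpa [N, weightSpaceOfIsLieTower, mem_weightSpace] using
      (hχ ▸ LieSubmodule.mem_top _ : m ∈ N)
  exact hm x hx

lemma eq_zero_of_mulVec_eq_zero {𝒮 : Set (Submodule K (ι → K))} (htop : sSup 𝒮 = ⊤)
    {Z : Matrix ι ι K} (hZ : ∀ p ∈ 𝒮, ∀ v ∈ p, Z *ᵥ v = 0) : Z = 0 := by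
  have : sSup 𝒮 ≤ LinearMap.ker Z.mulVecLin := sSup_le fun p hp v hv => hZ p hp v hv
  rw [htop, top_le_iff, LinearMap.ker_eq_top] at this
  rw [← Matrix.toLin'_apply'] at this
  simpa using this

variable [CharZero K] [IsAlgClosed K]

lemma hasTrivialRadical_of_sSup_eq_top {𝔫 : LieSubalgebra K (Matrix ι ι K)}
    {𝒮 : Set (Submodule K (ι → K))} (htop : sSup 𝒮 = ⊤) (hbot : ∀ p ∈ 𝒮, p ≠ ⊥)
    (hinv : ∀ p ∈ 𝒮, ∀ A ∈ 𝔫, ∀ v ∈ p, A *ᵥ v ∈ p)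
    (hirr : ∀ p ∈ 𝒮, ∀ q ≤ p, (∀ A ∈ 𝔫, ∀ v ∈ q, A *ᵥ v ∈ q) → q = ⊥ ∨ q = p)
    (hscalar : ∀ p ∈ 𝒮, ∀ A ∈ 𝔫, ∀ c : K, (∀ v ∈ p, A *ᵥ v = c • v) → c = 0) :
    HasTrivialRadical K 𝔫 := by
  rw [hasTrivialRadical_iff, LieSubmodule.eq_bot_iff]
  intro x hx
  refine Subtype.ext (eq_zero_of_mulVec_eq_zero htop fun p hp => ?_)
  let P : LieSubmodule K 𝔫 (ι → K) := { p with lie_mem := fun {A v} hv => hinv p hp A A.2 v hv }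
  have hP : Nontrivial P := by
    rw [LieSubmodule.nontrivial_iff_ne_bot]
    intro h
    exact hbot p hp (congrArg LieSubmodule.toSubmodule h)
  have : IsIrreducible K 𝔫 P := by
    refine LieModule.IsIrreducible.mk fun Q hQ => ?_
    have hQ' : ∀ A ∈ 𝔫, ∀ v ∈ Q.toSubmodule.map p.subtype,
        A *ᵥ v ∈ Q.toSubmodule.map p.subtype := by
      rintro A hA _ ⟨v, hv, rfl⟩
      exact ⟨_, Q.lie_mem (x := (⟨A, hA⟩ : 𝔫)) hv, rfl⟩
    rcases hirr p hp _ (Submodule.map_subtype_le _ _) hQ' with h | h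
    · refine absurd ?_ hQ
      rw [← LieSubmodule.toSubmodule_inj]
      refine Submodule.map_injective_of_injective p.injective_subtype ?_
      exact h.trans (Submodule.map_bot _).symm
    · rw [← LieSubmodule.toSubmodule_inj]
      refine Submodule.map_injective_of_injective p.injective_subtype ?_
      exact h.trans (Submodule.map_subtype_top p).symm
  obtain ⟨c, hc⟩ := exists_lie_eq_smul_of_mem_radical (P := P) hx
  have hc' : ∀ v ∈ p, (x : Matrix ι ι K) *ᵥ v = c • v := fun v hv =>
    congrArg Subtype.val (hc ⟨v, hv⟩)
  intro v hv
  rw [hc' v hv, hscalar p hp x x.2 c hc', zero_smul]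

theorem le_of_lie_mem {𝔫 : LieSubalgebra K (Matrix ι ι K)} {𝔪 : Submodule K (Matrix ι ι K)}
    (hle : 𝔫.toSubmodule ≤ 𝔪) (hlie : ∀ A ∈ 𝔪, ∀ B ∈ 𝔫, ⁅A, B⁆ ∈ 𝔫)
    {𝒮 : Set (Submodule K (ι → K))} (htop : sSup 𝒮 = ⊤) (hbot : ∀ p ∈ 𝒮, p ≠ ⊥)
    (hinv : ∀ p ∈ 𝒮, ∀ A ∈ 𝔪, ∀ v ∈ p, A *ᵥ v ∈ p)
    (hirr : ∀ p ∈ 𝒮, ∀ q ≤ p, (∀ A ∈ 𝔫, ∀ v ∈ q, A *ᵥ v ∈ q) → q = ⊥ ∨ q = p)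
    (hscalar : ∀ p ∈ 𝒮, ∀ A ∈ 𝔪, ∀ c : K, (∀ v ∈ p, A *ᵥ v = c • v) → c = 0) :
    𝔪 ≤ 𝔫.toSubmodule := by
  intro A hA
  have := hasTrivialRadical_of_sSup_eq_top htop hbot (fun p hp B hB => hinv p hp B (hle hB)) hirr
    (fun p hp B hB => hscalar p hp B (hle hB))
  let D : LieDerivation K 𝔫 𝔫 :=
    { toFun := fun B => ⟨⁅A, (B : Matrix ι ι K)⁆, hlie A hA B B.2⟩
      map_add' := fun B C => Subtype.ext (lie_add _ _ _)
      map_smul' := fun c B => Subtype.ext (lie_smul _ _ _)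
      leibniz' := fun B C => Subtype.ext (by
        change ⁅A, ⁅(B : Matrix ι ι K), (C : Matrix ι ι K)⁆⁆ =
          ⁅(B : Matrix ι ι K), ⁅A, (C : Matrix ι ι K)⁆⁆ -
            ⁅(C : Matrix ι ι K), ⁅A, (B : Matrix ι ι K)⁆⁆
        rw [leibniz_lie A, ← lie_skew ⁅A, (B : Matrix ι ι K)⁆ (C : Matrix ι ι K)]
        abel) }
  obtain ⟨B, hB⟩ := LieDerivation.IsKilling.exists_eq_ad D
  suffices A - B = 0 by
    rw [sub_eq_zero.mp this]
    exact B.2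
  have hcomm : ∀ C ∈ 𝔫, C * (A - B) = (A - B) * C := by
    intro C hC
    have h := congrArg Subtype.val (DFunLike.congr_fun hB ⟨C, hC⟩)
    rw [LieDerivation.ad_apply_apply] at h
    change ⁅(B : Matrix ι ι K), C⁆ = ⁅A, C⁆ at h
    rw [Ring.lie_def, Ring.lie_def] at h
    rw [sub_eq_sub_iff_add_eq_add] at h
    rw [mul_sub, sub_mul, sub_eq_sub_iff_add_eq_add, add_comm, h]
  have hmem : A - B ∈ 𝔪 := sub_mem hA (hle B.2)
  refine eq_zero_of_mulVec_eq_zero htop fun p hp => ?_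
  have : Nontrivial p := Submodule.nontrivial_iff_ne_bot.mpr (hbot p hp)
  obtain ⟨c, hc⟩ := Module.End.exists_eigenvalue
    ((A - B : Matrix ι ι K).mulVecLin.restrict (hinv p hp _ hmem))
  obtain ⟨w, hw, hw0⟩ := hc.exists_hasEigenvector
  have hw' : (A - B : Matrix ι ι K) *ᵥ (w : ι → K) = c • (w : ι → K) :=
    congrArg Subtype.val (Module.End.mem_eigenspace_iff.mp hw)
  let q : Submodule K (ι → K) :=
    p ⊓ LinearMap.ker ((A - B : Matrix ι ι K).mulVecLin - c • LinearMap.id)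
  have hq : ∀ v, v ∈ q ↔ v ∈ p ∧ (A - B : Matrix ι ι K) *ᵥ v = c • v := by
    intro v
    simp [q, sub_eq_zero, sub_mulVec]
  have hqp : q = p := by
    refine (hirr p hp q inf_le_left fun C hC v hv => ?_).resolve_left ?_
    · rw [hq] at hv ⊢
      refine ⟨hinv p hp C (hle hC) v hv.1, ?_⟩
      rw [mulVec_mulVec, ← hcomm C hC, ← mulVec_mulVec, hv.2, mulVec_smul]
    · intro h
      have : (w : ι → K) ∈ q := (hq _).mpr ⟨w.2, hw'⟩
      rw [h, Submodule.mem_bot] at this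
      exact hw0 (Subtype.ext this)
  have hall : ∀ v ∈ p, (A - B : Matrix ι ι K) *ᵥ v = c • v := fun v hv =>
    ((hq v).mp (hqp ▸ hv)).2
  intro v hv
  rw [hall v hv, hscalar p hp _ hmem c hall, zero_smul]

end Lie

section Tangent

lemma pair_tangent {M : Set (GL ι K)} {A : Matrix ι ι K} (hA : A ∈ tangent M)
    {φ : Module.Dual K (Matrix ι ι K)} {Z : Matrix ι ι (CoordRing ι K)}
    (hZ : ∀ g ∈ M, φ (Z.map (ev g)) = 0) : φ ((Z.map (leftDer A)).map (ev 1)) = 0 := by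
  rw [← ev_pair, ← leftDer_pair]
  exact mem_tangent.mp hA _ (mem_vanishing.mpr fun g hg => (ev_pair g φ Z).trans (hZ g hg))

/-- The matrix coefficient `A ↦ l (A v)`. -/
noncomputable def matCoeff (l : Module.Dual K (ι → K)) (v : ι → K) :
    Module.Dual K (Matrix ι ι K) where
  toFun A := l (A *ᵥ v)
  map_add' A B := by rw [add_mulVec, map_add]
  map_smul' c A := by rw [smul_mulVec, map_smul, RingHom.id_apply]

@[simp] lemma matCoeff_apply (l : Module.Dual K (ι → K)) (v : ι → K) (A : Matrix ι ι K) :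
    matCoeff l v A = l (A *ᵥ v) := rfl

lemma tangent_mulVec_mem {M : Set (GL ι K)} {p : Submodule K (ι → K)}
    (hp : ∀ g ∈ M, ∀ v ∈ p, (g : Matrix ι ι K) *ᵥ v ∈ p) {A : Matrix ι ι K}
    (hA : A ∈ tangent M) {v : ι → K} (hv : v ∈ p) : A *ᵥ v ∈ p := by
  rw [← Subspace.forall_mem_dualAnnihilator_apply_eq_zero_iff]
  intro l hl
  have := pair_tangent hA (φ := matCoeff l v) (Z := genX ι K) fun g hg => by
    rw [map_ev_genX, matCoeff_apply]
    exact (Submodule.mem_dualAnnihilator l).mp hl _ (hp g hg v hv)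
  simpa [Matrix.map_mul] using this

lemma pair_genX_mul_const (l : Module.Dual K (ι → K)) (v : ι → K) (A : Matrix ι ι K) :
    pair (matCoeff l v) (genX ι K * const A) = pair (matCoeff l (A *ᵥ v)) (genX ι K) := by
  ext m
  have h (φ : Module.Dual K (Matrix ι ι K)) (Z : Matrix ι ι (CoordRing ι K)) :
      coeff m (pair φ Z) = φ (Z.map (coeff m)) := map_pair_scalar (lcoeff K m) φ Z
  rw [h, h, matCoeff_apply, matCoeff_apply, mulVec_mulVec]
  congr 2
  ext i j
  simp [Matrix.mul_apply, const, coeff_sum, mul_comm _ (C _), mul_comm _ (A _ _)]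

lemma mulVec_mem_of_tangent {N : Subgroup (GL ι K)}
    (hN : N ≤ flatGroup (tangent (N : Set (GL ι K)))) {q : Submodule K (ι → K)}
    (hq : ∀ A ∈ tangent (N : Set (GL ι K)), ∀ v ∈ q, A *ᵥ v ∈ q) {g : GL ι K} (hg : g ∈ N)
    {v : ι → K} (hv : v ∈ q) : (g : Matrix ι ι K) *ᵥ v ∈ q := by
  let I : Ideal (CoordRing ι K) :=
    Ideal.span {F | ∃ l ∈ q.dualAnnihilator, ∃ w ∈ q, F = pair (matCoeff l w) (genX ι K)}
  have hI : I ≤ flatIdeal (tangent (N : Set (GL ι K))) := by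
    apply le_flatIdeal
    · rw [Ideal.span_le]
      rintro _ ⟨l, hl, w, hw, rfl⟩
      rw [SetLike.mem_coe, mem_maxOne, ev_pair]
      simpa using (Submodule.mem_dualAnnihilator l).mp hl w hw
    · intro A hA F hF
      induction hF using Submodule.span_induction with
      | mem x hx =>
        obtain ⟨l, hl, w, hw, rfl⟩ := hx
        rw [leftDer_pair, map_leftDer_genX, pair_genX_mul_const]
        exact Ideal.subset_span ⟨l, hl, _, hq A hA w hw, rfl⟩
      | zero => simp
      | add x y _ _ hx hy => simpa using add_mem hx hy
      | smul a x hx' hx =>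
        rw [smul_eq_mul, Derivation.leibniz]
        exact add_mem (Ideal.mul_mem_left _ _ hx) (Ideal.mul_mem_right _ _ hx')
  rw [← Subspace.forall_mem_dualAnnihilator_apply_eq_zero_iff]
  intro l hl
  have := (mem_flatGroup.mp (hN hg) _ (hI (Ideal.subset_span ⟨l, hl, v, hv, rfl⟩))).1
  rwa [ev_pair, map_ev_genX, matCoeff_apply] at this

lemma conj_mem_tangent {N : Set (GL ι K)} {g : GL ι K} (hg : ∀ u ∈ N, g * u * g⁻¹ ∈ N)
    {B : Matrix ι ι K} (hB : B ∈ tangent N) :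
    (g : Matrix ι ι K) * B * ((g⁻¹ : GL ι K) : Matrix ι ι K) ∈ tangent N := by
  rw [mem_tangent]
  intro F hF
  have h := mem_tangent.mp hB (trans g g⁻¹ F) <| mem_vanishing.mpr fun u hu => by
    rw [ev_trans]
    exact mem_vanishing.mp hF _ (hg u hu)
  rw [leftDer_trans, ev_trans] at h
  simpa using h

lemma lie_mem_tangent_of_normalizes {M : Set (GL ι K)} {N : Set (GL ι K)}
    (hMN : ∀ g ∈ M, ∀ u ∈ N, g * u * g⁻¹ ∈ N) {A B : Matrix ι ι K} (hA : A ∈ tangent M)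
    (hB : B ∈ tangent N) : ⁅A, B⁆ ∈ tangent N := by
  rw [← Subspace.forall_mem_dualAnnihilator_apply_eq_zero_iff]
  intro φ hφ
  have := pair_tangent hA (φ := φ) (Z := genX ι K * const B * genY ι K) fun g hg => by
    rw [Matrix.map_mul, Matrix.map_mul, map_ev_genX, map_ev_genY, map_const_scalar]
    exact (Submodule.mem_dualAnnihilator φ).mp hφ _ (conj_mem_tangent (hMN g hg) hB)
  have h : ((genX ι K * const B * genY ι K).map (leftDer A)).map (ev 1) = ⁅A, B⁆ := by
    rw [map_derivation_mul, map_derivation_mul, map_leftDer_genX, map_leftDer_genY,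
      map_derivation_const, mul_zero, add_zero, mul_neg, ← sub_eq_add_neg,
      Matrix.map_sub _ (map_sub _)]
    simp [Matrix.map_mul, Ring.lie_def]
  rwa [h] at this

lemma tangent_mono {M N : Set (GL ι K)} (h : N ⊆ M) : tangent N ≤ tangent M := fun _ hA =>
  mem_tangent.mpr fun F hF =>
    mem_tangent.mp hA F (mem_vanishing.mpr fun g hg => mem_vanishing.mp hF g (h hg))

open TrivSqZeroExt in
lemma ev_one_derivation_det (D : Derivation K (CoordRing ι K) (CoordRing ι K))
    {Z : Matrix ι ι (CoordRing ι K)} (hZ : Z.map (ev 1) = 1) :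
    ev 1 (D Z.det) = ((Z.map D).map (ev 1)).trace := by
  let θ : CoordRing ι K →+* DualNumber K :=
    { toFun := fun F => inl (ev 1 F) + inr (ev 1 (D F))
      map_one' := by ext <;> simp
      map_zero' := by ext <;> simp
      map_add' := fun F G => by ext <;> simp
      map_mul' := fun F G => by ext <;> simp [mul_comm, add_comm] }
  have hθ (F : CoordRing ι K) : (θ F).snd = ev 1 (D F) := by simp [θ]
  have hdet : θ Z.det = (Z.map θ).det := θ.map_det Z
  have hmap : Z.map θ = 1 + (DualNumber.eps : DualNumber K) •
      ((Z.map D).map (ev 1)).map (algebraMap K (DualNumber K)) := by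
    ext i j
    · have := congrFun (congrFun hZ i) j
      simp only [Matrix.map_apply] at this
      by_cases hij : i = j
      · subst hij
        simpa [θ, Matrix.add_apply, TrivSqZeroExt.algebraMap_eq_inl] using this
      · simpa [θ, Matrix.add_apply, TrivSqZeroExt.algebraMap_eq_inl, hij] using this
    · by_cases hij : i = j
      · subst hij
        simp [θ, Matrix.add_apply, TrivSqZeroExt.algebraMap_eq_inl]
      · simp [θ, Matrix.add_apply, TrivSqZeroExt.algebraMap_eq_inl, hij]
  rw [← hθ, hdet, hmap, det_one_add_smul, DualNumber.eps_pow_two, mul_zero, add_zero]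
  rw [← AddMonoidHom.map_trace (algebraMap K (DualNumber K))]
  simp [TrivSqZeroExt.algebraMap_eq_inl]

lemma eq_zero_of_det_pow_eq_one [CharZero K] {M : Set (GL ι K)} {p : Submodule K (ι → K)}
    (hp : p ≠ ⊥) {P : Matrix ι ι K} (hP : LinearMap.IsProj p P.mulVecLin) {m : ℕ} (hm : 0 < m)
    (hdet : ∀ g ∈ M, (P * (g : Matrix ι ι K) * P + (1 - P)).det ^ m = 1)
    {A : Matrix ι ι K} (hA : A ∈ tangent M) {c : K} (hc : ∀ v ∈ p, A *ᵥ v = c • v) :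
    c = 0 := by
  have hPP : P * P = P := ext_iff_mulVec.mpr fun v => by
    rw [← mulVec_mulVec]
    exact hP.map_id _ (hP.map_mem v)
  have hPAP : P * A * P = c • P := ext_iff_mulVec.mpr fun v => by
    rw [← mulVec_mulVec, ← mulVec_mulVec, hc (P *ᵥ v) (hP.map_mem v), mulVec_smul, smul_mulVec]
    exact congrArg (c • ·) (hP.map_id _ (hP.map_mem v))
  set Z : Matrix ι ι (CoordRing ι K) := const P * genX ι K * const P + const (1 - P) with hZdef
  have hZ (g : GL ι K) : Z.map (ev g) = P * (g : Matrix ι ι K) * P + (1 - P) := by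
    rw [hZdef, Matrix.map_add _ (map_add _)]
    simp [Matrix.map_mul]
  have hev (g : GL ι K) : ev g Z.det = (P * (g : Matrix ι ι K) * P + (1 - P)).det := by
    rw [← hZ]
    exact (ev g).map_det Z
  have hZ1 : Z.map (ev 1) = 1 := by
    rw [hZ, Units.val_one, mul_one, hPP, add_sub_cancel]
  have hone : ev 1 Z.det = 1 := by
    rw [hev, ← hZ, hZ1, det_one]
  have hder := mem_tangent.mp hA (Z.det ^ m - 1) <| mem_vanishing.mpr fun g hg => by
    rw [map_sub, map_pow, hev, hdet g hg, map_one, sub_self]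
  have hZA : (Z.map (leftDer A)).map (ev 1) = P * A * P := by
    rw [hZdef, Matrix.map_add _ (map_add _), map_derivation_mul, map_derivation_mul]
    simp [Matrix.map_mul]
  rw [map_sub, Derivation.map_one_eq_zero, sub_zero, Derivation.leibniz_pow] at hder
  simp only [map_nsmul, smul_eq_mul, map_mul, map_pow, hone, one_pow, one_mul] at hder
  rw [ev_one_derivation_det _ hZ1, hZA, hPAP, trace_smul, smul_eq_mul, nsmul_eq_mul] at hder
  have htr : P.trace = (Module.finrank K p : K) := by
    rw [← hP.trace, ← Matrix.trace_toLin'_eq, Matrix.toLin'_apply']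
  have hrank : Module.finrank K p ≠ 0 := by
    rwa [Ne, Submodule.finrank_eq_zero]
  rw [htr] at hder
  simpa [hm.ne', hrank] using hder

end Tangent

section Main

variable [CharZero K] [IsAlgClosed K]

attribute [local instance] LieRing.ofAssociativeRing in
theorem finiteIndex_of_admissible {M N : Subgroup (GL ι K)} (hNM : N ≤ M)
    (hN : IsAlgebraicSet (N : Set (GL ι K)))
    (hconn : ∀ S ≤ N, IsAlgebraicSet (S : Set (GL ι K)) → (S.subgroupOf N).FiniteIndex → N ≤ S)
    (hnormal : ∀ g ∈ M, ∀ u ∈ N, g * u * g⁻¹ ∈ N)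
    {𝒮 : Set (Submodule K (ι → K))} (htop : sSup 𝒮 = ⊤) (hbot : ∀ p ∈ 𝒮, p ≠ ⊥)
    (hinv : ∀ p ∈ 𝒮, ∀ g ∈ M, ∀ v ∈ p, (g : Matrix ι ι K) *ᵥ v ∈ p)
    (hirr : ∀ p ∈ 𝒮, ∀ q ≤ p, (∀ g ∈ N, ∀ v ∈ q, (g : Matrix ι ι K) *ᵥ v ∈ q) →
      q = ⊥ ∨ q = p)
    (hdet : ∀ p ∈ 𝒮, ∃ P : Matrix ι ι K, LinearMap.IsProj p P.mulVecLin ∧ ∃ m : ℕ, 0 < m ∧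
      ∀ g ∈ M, (P * (g : Matrix ι ι K) * P + (1 - P)).det ^ m = 1) :
    (N.subgroupOf M).FiniteIndex := by
  have hflat : N ≤ flatGroup (tangent (N : Set (GL ι K))) :=
    hconn _ (flatGroup_tangent_le hN) (isAlgebraicSet_flatGroup _) (finiteIndex_flatGroup N)
  let 𝔫 : LieSubalgebra K (Matrix ι ι K) :=
    { tangent (N : Set (GL ι K)) with lie_mem' := fun hA hB => lie_mem_tangent hA hB }
  have hle : tangent (M : Set (GL ι K)) ≤ tangent (N : Set (GL ι K)) :=
    le_of_lie_mem (𝔫 := 𝔫) (tangent_mono hNM)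
      (fun A hA B hB => lie_mem_tangent_of_normalizes hnormal hA hB) htop hbot
      (fun p hp A hA v hv => tangent_mulVec_mem (hinv p hp) hA hv)
      (fun p hp q hq h => hirr p hp q hq fun g hg v hv => mulVec_mem_of_tangent hflat h hg hv)
      fun p hp A hA c hc => by
        obtain ⟨P, hP, m, hm, h⟩ := hdet p hp
        exact eq_zero_of_det_pow_eq_one (hbot p hp) hP hm h hA hc
  have heq := le_antisymm hle (tangent_mono hNM)
  have hfin := finiteIndex_flatGroup M
  rw [heq] at hfin
  have hmono : (flatGroup (tangent (N : Set (GL ι K)))).subgroupOf M ≤ N.subgroupOf M :=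
    Subgroup.comap_mono (flatGroup_tangent_le hN)
  exact Subgroup.finiteIndex_of_le hmono

end Main

section Closure

lemma isAlgebraicSet_setOf_forall {κ : Sort*} (F : κ → CoordRing ι K) :
    IsAlgebraicSet {g : GL ι K | ∀ k, ev g (F k) = 0} :=
  ⟨Set.range F, by simp⟩

lemma IsAlgebraicSet.inter {C D : Set (GL ι K)} (hC : IsAlgebraicSet C) (hD : IsAlgebraicSet D) :
    IsAlgebraicSet (C ∩ D) := by
  obtain ⟨T, rfl⟩ := hC
  obtain ⟨U, rfl⟩ := hD
  refine ⟨T ∪ U, ?_⟩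
  ext g
  simp only [Set.mem_inter_iff, Set.mem_ofPred_eq, Set.mem_union, or_imp, forall_and]

lemma IsAlgebraicSet.iInter {κ : Sort*} {C : κ → Set (GL ι K)}
    (hC : ∀ k, IsAlgebraicSet (C k)) : IsAlgebraicSet (⋂ k, C k) := by
  choose T hT using hC
  refine ⟨⋃ k, T k, ?_⟩
  ext g
  simp only [Set.mem_iInter, hT, Set.mem_ofPred_eq, Set.mem_iUnion, forall_exists_index]
  exact forall_comm

lemma IsAlgebraicSet.preimage {C : Set (GL ι K)} (hC : IsAlgebraicSet C) {f : GL ι K → GL ι K}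
    (θ : CoordRing ι K →ₐ[K] CoordRing ι K) (hθ : ∀ g F, ev g (θ F) = ev (f g) F) :
    IsAlgebraicSet (f ⁻¹' C) := by
  obtain ⟨T, rfl⟩ := hC
  refine ⟨θ '' T, ?_⟩
  ext g
  simp [hθ]

lemma IsAlgebraicSet.preimage_inv {C : Set (GL ι K)} (hC : IsAlgebraicSet C) :
    IsAlgebraicSet ((fun g => g⁻¹) ⁻¹' C) :=
  hC.preimage invSubst ev_invSubst

lemma IsAlgebraicSet.preimage_conj {C : Set (GL ι K)} (hC : IsAlgebraicSet C) (g : GL ι K) :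
    IsAlgebraicSet ((fun u => g * u * g⁻¹) ⁻¹' C) :=
  hC.preimage (trans g g⁻¹) fun u F => ev_trans g g⁻¹ u F

lemma IsAlgebraicSet.preimage_conj_right {C : Set (GL ι K)} (hC : IsAlgebraicSet C)
    (u : GL ι K) : IsAlgebraicSet ((fun g => g * u * g⁻¹) ⁻¹' C) := by
  refine hC.preimage (evalPair (genX ι K * const u * genY ι K)
    (genX ι K * const ((u⁻¹ : GL ι K) : Matrix ι ι K) * genY ι K)) fun g F => ?_
  suffices (ev g).comp (evalPair (genX ι K * const u * genY ι K)
      (genX ι K * const ((u⁻¹ : GL ι K) : Matrix ι ι K) * genY ι K)) = ev (g * u * g⁻¹) from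
    DFunLike.congr_fun this F
  apply algHom_ext_gen
  · rw [AlgHom.coe_comp, ← Matrix.map_map, map_evalPair_genX]
    simp [Matrix.map_mul]
  · rw [AlgHom.coe_comp, ← Matrix.map_map, map_evalPair_genY]
    simp [Matrix.map_mul, mul_assoc]

/-- `M` is the smallest algebraic group containing `S`. -/
structure IsAlgClosure (S : Set (GL ι K)) (M : Subgroup (GL ι K)) : Prop where
  subset : S ⊆ M
  isAlgebraicSet : IsAlgebraicSet (M : Set (GL ι K))
  le : ∀ M' : Subgroup (GL ι K), S ⊆ M' → IsAlgebraicSet (M' : Set (GL ι K)) → M ≤ M'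

lemma IsAlgClosure.conj_mem {Γ Δ M N : Subgroup (GL ι K)} (hM : IsAlgClosure (Γ : Set (GL ι K)) M)
    (hN : IsAlgClosure (Δ : Set (GL ι K)) N) (h : ∀ g ∈ Γ, ∀ u ∈ Δ, g * u * g⁻¹ ∈ Δ) :
    ∀ g ∈ M, ∀ u ∈ N, g * u * g⁻¹ ∈ N := by
  have hΓ : ∀ g ∈ Γ, ∀ u ∈ N, g * u * g⁻¹ ∈ N := by
    intro g hg
    exact hN.le (N.comap (MulAut.conj g).toMonoidHom) (fun u hu => hN.subset (h g hg u hu))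
      (hN.isAlgebraicSet.preimage_conj g)
  let R : Subgroup (GL ι K) :=
    { carrier := {g | ∀ u : N, g * u * g⁻¹ ∈ N ∧ g⁻¹ * u * g⁻¹⁻¹ ∈ N}
      one_mem' := by simp
      mul_mem' := fun {g k} hg hk u => by
        refine ⟨?_, ?_⟩
        · simpa [mul_assoc] using (hg ⟨_, (hk u).1⟩).1
        · simpa [mul_assoc] using (hk ⟨_, (hg u).2⟩).2
      inv_mem' := fun {g} hg u => by simpa [and_comm] using hg u }
  have hR : (R : Set (GL ι K)) = ⋂ u : N, ((fun g => g * (u : GL ι K) * g⁻¹) ⁻¹' N) ∩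
      ((fun g => g⁻¹) ⁻¹' ((fun g => g * (u : GL ι K) * g⁻¹) ⁻¹' N)) := by
    ext g
    simp [R]
  have hle : M ≤ R := by
    refine hM.le R (fun g hg u => ⟨hΓ g hg u u.2, hΓ g⁻¹ (inv_mem hg) u u.2⟩) ?_
    rw [hR]
    exact .iInter fun u => (hN.isAlgebraicSet.preimage_conj_right _).inter
      (hN.isAlgebraicSet.preimage_conj_right _).preimage_inv
  exact fun g hg u hu => (hle hg ⟨u, hu⟩).1

lemma isAlgebraicSet_mulVec_mem (p : Submodule K (ι → K)) :
    IsAlgebraicSet {g : GL ι K | ∀ v ∈ p, (g : Matrix ι ι K) *ᵥ v ∈ p} := by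
  convert isAlgebraicSet_setOf_forall (ι := ι) (K := K)
    (fun k : p × p.dualAnnihilator => pair (matCoeff k.2 k.1) (genX ι K)) using 1
  ext g
  simp only [ev_pair, map_ev_genX, matCoeff_apply, Set.mem_ofPred_eq, Prod.forall, Subtype.forall,
    Subspace.forall_mem_dualAnnihilator_apply_eq_zero_iff]

/-- The stabilizer of a subspace. -/
def stab (p : Submodule K (ι → K)) : Subgroup (GL ι K) where
  carrier := {g | (∀ v ∈ p, (g : Matrix ι ι K) *ᵥ v ∈ p) ∧
    ∀ v ∈ p, ((g⁻¹ : GL ι K) : Matrix ι ι K) *ᵥ v ∈ p}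
  one_mem' := by simp
  mul_mem' {g k} hg hk := by
    refine ⟨fun v hv => ?_, fun v hv => ?_⟩
    · simpa [← mulVec_mulVec] using hg.1 _ (hk.1 v hv)
    · rw [_root_.mul_inv_rev, Units.val_mul, ← mulVec_mulVec]
      exact hk.2 _ (hg.2 v hv)
  inv_mem' {g} hg := ⟨hg.2, by simpa only [inv_inv] using hg.1⟩

lemma isAlgebraicSet_stab (p : Submodule K (ι → K)) :
    IsAlgebraicSet (stab p : Set (GL ι K)) :=
  (isAlgebraicSet_mulVec_mem p).inter (isAlgebraicSet_mulVec_mem p).preimage_inv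

lemma IsAlgClosure.le_stab {Γ M : Subgroup (GL ι K)} (hM : IsAlgClosure (Γ : Set (GL ι K)) M)
    {p : Submodule K (ι → K)} (hp : ∀ g ∈ Γ, ∀ v ∈ p, (g : Matrix ι ι K) *ᵥ v ∈ p) :
    M ≤ stab p :=
  hM.le _ (fun g hg => ⟨hp g hg, hp g⁻¹ (inv_mem hg)⟩) (isAlgebraicSet_stab p)

lemma det_compression_mul {p : Submodule K (ι → K)} {P : Matrix ι ι K}
    (hP : LinearMap.IsProj p P.mulVecLin) (A : Matrix ι ι K) {B : Matrix ι ι K}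
    (hB : ∀ v ∈ p, B *ᵥ v ∈ p) :
    (P * (A * B) * P + (1 - P)).det = (P * A * P + (1 - P)).det * (P * B * P + (1 - P)).det := by
  have hPP : P * P = P := ext_iff_mulVec.mpr fun v => by
    rw [← mulVec_mulVec]
    exact hP.map_id _ (hP.map_mem v)
  have hPB : P * (B * P) = B * P := ext_iff_mulVec.mpr fun v => by
    rw [← mulVec_mulVec, ← mulVec_mulVec]
    exact hP.map_id _ (hB _ (hP.map_mem v))
  rw [← det_mul]
  congr 1
  have h₁ : P * A * P * (P * B * P) = P * (A * B) * P := by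
    rw [mul_assoc P B P, hPB, mul_assoc (P * A) P, hPB]
    simp only [mul_assoc]
  have h₂ : P * A * P * (1 - P) = 0 := by rw [mul_sub, mul_one, mul_assoc _ P P, hPP, sub_self]
  have h₃ : (1 - P) * (P * B * P) = 0 := by
    rw [sub_mul, one_mul, ← mul_assoc P (P * B), ← mul_assoc P P, hPP, sub_self]
  have h₄ : (1 - P) * (1 - P) = 1 - P := by
    rw [mul_sub, mul_one, sub_mul, one_mul, hPP, sub_self, sub_zero]
  rw [add_mul, mul_add, mul_add, h₁, h₂, h₃, h₄, add_zero, zero_add]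

lemma IsAlgClosure.det_pow_eq_one {Γ M : Subgroup (GL ι K)}
    (hM : IsAlgClosure (Γ : Set (GL ι K)) M) {p : Submodule K (ι → K)}
    (hp : ∀ g ∈ Γ, ∀ v ∈ p, (g : Matrix ι ι K) *ᵥ v ∈ p) {P : Matrix ι ι K}
    (hP : LinearMap.IsProj p P.mulVecLin) {m : ℕ}
    (hdet : ∀ g ∈ Γ, (P * (g : Matrix ι ι K) * P + (1 - P)).det ^ m = 1) :
    ∀ g ∈ M, (P * (g : Matrix ι ι K) * P + (1 - P)).det ^ m = 1 := by
  have hone : (P * 1 * P + (1 - P)).det = 1 := by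
    have hPP : P * P = P := ext_iff_mulVec.mpr fun v => by
      rw [← mulVec_mulVec]
      exact hP.map_id _ (hP.map_mem v)
    rw [mul_one, hPP, add_sub_cancel, det_one]
  let R : Subgroup (GL ι K) :=
    { carrier := stab p ∩ {g | (P * (g : Matrix ι ι K) * P + (1 - P)).det ^ m = 1}
      one_mem' := ⟨one_mem _, by simp only [Set.mem_ofPred_eq, Units.val_one, hone, one_pow]⟩
      mul_mem' := fun {g k} hg hk => ⟨mul_mem hg.1 hk.1, by
        have h₁ := hg.2
        have h₂ := hk.2
        simp only [Set.mem_ofPred_eq] at h₁ h₂ ⊢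
        rw [Units.val_mul, det_compression_mul hP _ hk.1.1, mul_pow, h₁, h₂, one_mul]⟩
      inv_mem' := fun {g} hg => ⟨inv_mem hg.1, by
        have h₁ := hg.2
        simp only [Set.mem_ofPred_eq] at h₁ ⊢
        have h₂ := det_compression_mul hP (g : Matrix ι ι K) hg.1.2
        rw [← Units.val_mul, mul_inv_cancel, Units.val_one, hone] at h₂
        replace h₂ := congrArg (· ^ m) h₂
        simp only [one_pow, mul_pow, h₁, one_mul] at h₂
        exact h₂.symm⟩ }
  have hR : IsAlgebraicSet (R : Set (GL ι K)) := by
    refine (isAlgebraicSet_stab p).inter ?_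
    convert isAlgebraicSet_setOf_forall (ι := ι) (K := K) (fun _ : Unit =>
      (const P * genX ι K * const P + const (1 - P)).det ^ m - 1) using 1
    ext g
    have : ev g (const P * genX ι K * const P + const (1 - P)).det =
        (P * (g : Matrix ι ι K) * P + (1 - P)).det := by
      rw [AlgHom.map_det, AlgHom.mapMatrix_apply, Matrix.map_add _ (map_add _)]
      simp [Matrix.map_mul]
    simp [this, sub_eq_zero]
  exact fun g hg => (hM.le R (fun g hg => ⟨hM.le_stab hp (hM.subset hg), hdet g hg⟩) hR hg).2

theorem IsAlgClosure.finiteIndex [CharZero K] [IsAlgClosed K] {Γ Δ M N : Subgroup (GL ι K)}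
    (hM : IsAlgClosure (Γ : Set (GL ι K)) M) (hN : IsAlgClosure (Δ : Set (GL ι K)) N)
    (hle : Δ ≤ Γ) (hnormal : ∀ g ∈ Γ, ∀ u ∈ Δ, g * u * g⁻¹ ∈ Δ)
    (hconn : ∀ S ≤ N, IsAlgebraicSet (S : Set (GL ι K)) → (S.subgroupOf N).FiniteIndex → N ≤ S)
    {𝒮 : Set (Submodule K (ι → K))} (htop : sSup 𝒮 = ⊤) (hbot : ∀ p ∈ 𝒮, p ≠ ⊥)
    (hinv : ∀ p ∈ 𝒮, ∀ g ∈ Γ, ∀ v ∈ p, (g : Matrix ι ι K) *ᵥ v ∈ p)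
    (hirr : ∀ p ∈ 𝒮, ∀ q ≤ p, (∀ g ∈ Δ, ∀ v ∈ q, (g : Matrix ι ι K) *ᵥ v ∈ q) →
      q = ⊥ ∨ q = p)
    (hdet : ∀ p ∈ 𝒮, ∃ P : Matrix ι ι K, LinearMap.IsProj p P.mulVecLin ∧ ∃ m : ℕ, 0 < m ∧
      ∀ g ∈ Γ, (P * (g : Matrix ι ι K) * P + (1 - P)).det ^ m = 1) :
    (N.subgroupOf M).FiniteIndex := by
  refine finiteIndex_of_admissible (hN.le M (fun g hg => hM.subset (hle hg)) hM.isAlgebraicSet)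
    hN.isAlgebraicSet hconn (hM.conj_mem hN hnormal) htop hbot
    (fun p hp g hg => (hM.le_stab (hinv p hp) hg).1)
    (fun p hp q hq h => hirr p hp q hq fun g hg => h g (hN.subset hg)) fun p hp => ?_
  obtain ⟨P, hP, m, hm, h⟩ := hdet p hp
  exact ⟨P, hP, m, hm, hM.det_pow_eq_one (hinv p hp) hP h⟩

end Closure

section Coordinates

variable {V : Type*} [AddCommGroup V] [Module K V] (b : Module.Basis ι K V)

/-- The group isomorphism `GL(V) ≃ GL_n(K)` attached to a basis. -/
noncomputable def toGL : (V ≃ₗ[K] V) ≃* GL ι K :=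
  (LinearMap.GeneralLinearGroup.generalLinearEquiv K V).symm.trans
    (Units.mapEquiv (LinearMap.toMatrixAlgEquiv b).toMulEquiv)

lemma coe_toGL (g : V ≃ₗ[K] V) :
    (toGL b g : Matrix ι ι K) = LinearMap.toMatrixAlgEquiv b (g : V →ₗ[K] V) := rfl

lemma toMatrixAlgEquiv_mulVec (f : V →ₗ[K] V) (v : V) :
    LinearMap.toMatrixAlgEquiv b f *ᵥ b.equivFun v = b.equivFun (f v) :=
  LinearMap.toMatrix_mulVec_repr b b f v

/-- The polynomial function on pairs of endomorphisms attached to a coordinate polynomial. -/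
noncomputable def polyFun : CoordRing ι K →ₐ[K] (((V →ₗ[K] V) × (V →ₗ[K] V)) → K) :=
  AlgHom.pi fun P =>
    evalPair (LinearMap.toMatrixAlgEquiv b P.1) (LinearMap.toMatrixAlgEquiv b P.2)

lemma polyFun_apply (F : CoordRing ι K) (P : (V →ₗ[K] V) × (V →ₗ[K] V)) :
    polyFun b F P =
      evalPair (LinearMap.toMatrixAlgEquiv b P.1) (LinearMap.toMatrixAlgEquiv b P.2) F := rfl

lemma polyFun_coe (F : CoordRing ι K) (g : V ≃ₗ[K] V) :
    polyFun b F ((g : V →ₗ[K] V), ((g⁻¹ : V ≃ₗ[K] V) : V →ₗ[K] V)) = ev (toGL b g) F := by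
  rw [polyFun_apply, ev, ← map_inv, coe_toGL, coe_toGL]

lemma range_polyFun : (polyFun b).range = endPairPolynomials K V := by
  apply le_antisymm
  · rintro _ ⟨F, rfl⟩
    change polyFun b F ∈ _
    induction F using MvPolynomial.induction_on with
    | C c => exact (polyFun b).commutes c ▸ Subalgebra.algebraMap_mem _ c
    | add p q hp hq => exact map_add (polyFun b) p q ▸ add_mem hp hq
    | mul_X p s hp =>
      rw [map_mul]
      refine mul_mem hp (Algebra.subset_adjoin ?_)
      rcases s with ⟨i, j⟩ | ⟨i, j⟩
      · refine ⟨(Matrix.entryLinearMap K K i j) ∘ₗ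
          (LinearMap.toMatrixAlgEquiv b).toLinearMap ∘ₗ LinearMap.fst K _ _, ?_⟩
        ext P
        exact (evalPair_genX (K := K) (LinearMap.toMatrixAlgEquiv b P.1)
          (LinearMap.toMatrixAlgEquiv b P.2) i j).symm
      · refine ⟨(Matrix.entryLinearMap K K i j) ∘ₗ
          (LinearMap.toMatrixAlgEquiv b).toLinearMap ∘ₗ LinearMap.snd K _ _, ?_⟩
        ext P
        exact (evalPair_genY (K := K) (LinearMap.toMatrixAlgEquiv b P.1)
          (LinearMap.toMatrixAlgEquiv b P.2) i j).symm
  · refine Algebra.adjoin_le ?_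
    rintro _ ⟨φ, rfl⟩
    let τ := (LinearMap.toMatrixAlgEquiv b).symm.toLinearMap
    refine ⟨pair (φ ∘ₗ LinearMap.inl K _ _ ∘ₗ τ) (genX ι K) +
      pair (φ ∘ₗ LinearMap.inr K _ _ ∘ₗ τ) (genY ι K), ?_⟩
    ext P
    change polyFun b _ P = φ P
    have h (ψ : Module.Dual K (Matrix ι ι K)) (Z : Matrix ι ι (CoordRing ι K))
        (A B : Matrix ι ι K) : evalPair A B (pair ψ Z) = ψ (Z.map (evalPair A B)) :=
      map_pair_scalar (evalPair A B).toLinearMap ψ Z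
    rw [polyFun_apply, map_add, h, h, map_evalPair_genX, map_evalPair_genY]
    simp only [LinearMap.comp_apply, AlgEquiv.toLinearMap_apply, AlgEquiv.symm_apply_apply, τ,
      ← map_add]
    simp

lemma isZarClosed_iff {C : Set (V ≃ₗ[K] V)} :
    IsZarClosed C ↔ ∃ T : Set (CoordRing ι K), C = {g | ∀ F ∈ T, ev (toGL b g) F = 0} := by
  constructor
  · rintro ⟨T, hT, rfl⟩
    refine ⟨polyFun b ⁻¹' T, ?_⟩
    ext g
    simp only [Set.mem_ofPred_eq, Set.mem_preimage, ← polyFun_coe]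
    refine ⟨fun h F hF => h _ hF, fun h f hf => ?_⟩
    have := hT f hf
    rw [← range_polyFun b] at this
    obtain ⟨F, rfl⟩ := this
    exact h F hf
  · rintro ⟨T, rfl⟩
    refine ⟨polyFun b '' T, ?_, ?_⟩
    · rintro _ ⟨F, -, rfl⟩
      rw [← range_polyFun b]
      exact ⟨F, rfl⟩
    · ext g
      simp [← polyFun_coe]

lemma isZarClosed_comap {S : Subgroup (GL ι K)} (hS : IsAlgebraicSet (S : Set (GL ι K))) :
    IsZarClosed (S.comap (toGL b).toMonoidHom : Set (V ≃ₗ[K] V)) := by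
  obtain ⟨T, hT⟩ := hS
  refine (isZarClosed_iff b).mpr ⟨T, ?_⟩
  ext g
  change toGL b g ∈ (S : Set (GL ι K)) ↔ _
  rw [hT]
  rfl

lemma isAlgebraicSet_map {S : Subgroup (V ≃ₗ[K] V)} (hS : IsZarClosed (S : Set (V ≃ₗ[K] V))) :
    IsAlgebraicSet (S.map (toGL b).toMonoidHom : Set (GL ι K)) := by
  obtain ⟨T, hT⟩ := (isZarClosed_iff b).mp hS
  refine ⟨T, ?_⟩
  ext g
  obtain ⟨u, rfl⟩ := (toGL b).surjective g
  change toGL b u ∈ S.map (toGL b).toMonoidHom ↔ _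
  have : toGL b u ∈ S.map (toGL b).toMonoidHom ↔ u ∈ (S : Set (V ≃ₗ[K] V)) :=
    Subgroup.mem_map_iff_mem (toGL b).injective
  rw [this, hT]
  rfl

end Coordinates

end MatrixGroup

section ZariskiClosure

variable {K V : Type*} [Field K] [AddCommGroup V] [Module K V]

lemma subset_zarSubgroupClosure (S : Set (V ≃ₗ[K] V)) : S ⊆ zarSubgroupClosure S := by
  intro g hg
  simp only [zarSubgroupClosure, SetLike.mem_coe, Subgroup.mem_iInf]
  exact fun H hH => hH.1 hg

lemma zarSubgroupClosure_le {S : Set (V ≃ₗ[K] V)} {M : Subgroup (V ≃ₗ[K] V)} (hS : S ⊆ M)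
    (hM : IsZarClosed (M : Set (V ≃ₗ[K] V))) : zarSubgroupClosure S ≤ M :=
  iInf₂_le M ⟨hS, hM⟩

lemma IsZarClosed.biInter {κ : Type*} {I : Set κ} {C : κ → Set (V ≃ₗ[K] V)}
    (hC : ∀ k ∈ I, IsZarClosed (C k)) : IsZarClosed (⋂ k ∈ I, C k) := by
  choose! T hT hC using hC
  refine ⟨⋃ k ∈ I, T k, ?_, ?_⟩
  · intro f hf
    obtain ⟨k, hk, hf⟩ := Set.mem_iUnion₂.mp hf
    exact hT k hk f hf
  · ext g
    simp only [Set.mem_iInter, Set.mem_ofPred_eq, Set.mem_iUnion]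
    constructor
    · rintro h f ⟨k, hk, hf⟩
      have := h k hk
      rw [hC k hk] at this
      exact this f hf
    · intro h k hk
      rw [hC k hk]
      exact fun f hf => h f ⟨k, hk, hf⟩

lemma isZarClosed_zarSubgroupClosure (S : Set (V ≃ₗ[K] V)) :
    IsZarClosed (zarSubgroupClosure S : Set (V ≃ₗ[K] V)) := by
  rw [zarSubgroupClosure]
  simp only [Subgroup.coe_iInf]
  exact .biInter fun M hM => hM.2

lemma IsZarClosed.inter {C D : Set (V ≃ₗ[K] V)} (hC : IsZarClosed C) (hD : IsZarClosed D) :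
    IsZarClosed (C ∩ D) := by
  obtain ⟨T, hT, rfl⟩ := hC
  obtain ⟨U, hU, rfl⟩ := hD
  refine ⟨T ∪ U, fun f hf => hf.elim (hT f) (hU f), ?_⟩
  ext g
  simp only [Set.mem_inter_iff, Set.mem_ofPred_eq, Set.mem_union, or_imp, forall_and]

lemma MatrixGroup.isAlgClosure_map {ι : Type*} [Fintype ι] [DecidableEq ι]
    (b : Module.Basis ι K V) (Γ : Subgroup (V ≃ₗ[K] V)) :
    IsAlgClosure (Γ.map (toGL b).toMonoidHom : Set (GL ι K))
      ((zarSubgroupClosure (Γ : Set (V ≃ₗ[K] V))).map (toGL b).toMonoidHom) where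
  subset := Set.image_mono (subset_zarSubgroupClosure _)
  isAlgebraicSet := isAlgebraicSet_map b (isZarClosed_zarSubgroupClosure _)
  le M' hM' hM'c := by
    rw [Subgroup.map_le_iff_le_comap]
    exact zarSubgroupClosure_le (fun g hg => hM' ⟨g, hg, rfl⟩) (isZarClosed_comap b hM'c)

lemma identityComponent_le {M S : Subgroup (V ≃ₗ[K] V)} (hS : S ≤ M)
    (hSc : IsZarClosed (S : Set (V ≃ₗ[K] V))) (hfin : (S.subgroupOf M).FiniteIndex) :
    identityComponent M ≤ S :=
  iInf₂_le S ⟨hS, hSc, hfin⟩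

end ZariskiClosure

section Representation

variable {K V : Type*} [Field K] [AddCommGroup V] [Module K V] [FiniteDimensional K V]
  {G : Type*} [Group G] {ρ : G →* (V ≃ₗ[K] V)} {G' : Subgroup G}

lemma exists_isSimpleOn_le {q : Submodule K V} (hq : IsInvariantOn ρ G' q) (hq0 : q ≠ ⊥) :
    ∃ p ≤ q, IsSimpleOn ρ G' p := by
  obtain ⟨p, ⟨hp, hp0, hpq⟩, hmin⟩ := (wellFounded_lt (α := Submodule K V)).has_min
    {p | IsInvariantOn ρ G' p ∧ p ≠ ⊥ ∧ p ≤ q} ⟨q, hq, hq0, le_rfl⟩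
  refine ⟨p, hpq, hp, hp0, fun r hr hrinv => ?_⟩
  by_contra! h
  exact hmin r ⟨hrinv, h.1, hr.trans hpq⟩ (lt_of_le_of_ne hr h.2)

lemma IsSemisimpleOn.sSup_isSimpleOn (h : IsSemisimpleOn ρ G') :
    sSup {p | IsSimpleOn ρ G' p} = ⊤ := by
  have hinv : IsInvariantOn ρ G' (sSup {p | IsSimpleOn ρ G' p}) := by
    intro g hg
    have : sSup {p | IsSimpleOn ρ G' p} ≤
        (sSup {p | IsSimpleOn ρ G' p}).comap (ρ g : V →ₗ[K] V) :=
      sSup_le fun p hp v hv => Submodule.mem_comap.mpr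
        (le_sSup (a := p) hp (hp.1 g hg v hv))
    exact fun v hv => this hv
  obtain ⟨q, hq, hcompl⟩ := h _ hinv
  by_cases hq0 : q = ⊥
  · subst hq0
    simpa using hcompl.sup_eq_top
  · obtain ⟨p, hpq, hp⟩ := exists_isSimpleOn_le hq hq0
    exact absurd (le_bot_iff.mp (hcompl.disjoint (le_sSup hp) hpq)) hp.2.1

lemma det_compression {p : Submodule K V} {π : V →ₗ[K] V} (hπ : LinearMap.IsProj p π)
    (g : V →ₗ[K] V) (hg : ∀ v ∈ p, g v ∈ p) :
    LinearMap.det (π * g * π + (1 - π)) = LinearMap.det (g.restrict hg) := by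
  have hp : p ≤ p.comap (π * g * π + (1 - π)) := fun v hv => by
    simpa [hπ.map_id v hv] using hπ.map_mem (g v)
  rw [LinearMap.det_eq_det_mul_det p _ hp]
  have h₁ : (π * g * π + (1 - π)).restrict hp = g.restrict hg := by
    ext v
    simp [hπ.map_id _ v.2, hπ.map_id _ (hg _ v.2)]
  have h₂ : p.mapQ p (π * g * π + (1 - π)) hp = LinearMap.id := by
    ext v
    simp only [LinearMap.comp_apply, Submodule.mkQ_apply, Submodule.mapQ_apply, LinearMap.id_apply]
    rw [Submodule.Quotient.eq]
    have : (π * g * π + (1 - π)) v - v = π (g (π v)) - π v := by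
      simp
      abel
    rw [this]
    exact sub_mem (hπ.map_mem _) (hπ.map_mem _)
  rw [h₁, h₂, LinearMap.det_id, mul_one]

end Representation

section Monodromy

open MatrixGroup Matrix

variable {K V : Type*} [Field K] [AddCommGroup V] [Module K V]
  {G : Type*} [Group G] {H : Subgroup G} {ρ : G →* (V ≃ₗ[K] V)}

lemma monodromyGroup_eq (ρ : G →* (V ≃ₗ[K] V)) :
    monodromyGroup ρ = zarSubgroupClosure (ρ.range : Set (V ≃ₗ[K] V)) := by
  rw [monodromyGroup, MonoidHom.coe_range]

lemma monodromyGroup_comp_subtype_le (H : Subgroup G) (ρ : G →* (V ≃ₗ[K] V)) :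
    monodromyGroup (ρ.comp H.subtype) ≤ monodromyGroup ρ := by
  refine zarSubgroupClosure_le ?_ (isZarClosed_zarSubgroupClosure _)
  rintro _ ⟨h, rfl⟩
  exact subset_zarSubgroupClosure _ ⟨h, rfl⟩

lemma exists_isProj_det_pow_eq_one {ι : Type*} [Fintype ι] [DecidableEq ι]
    (b : Module.Basis ι K V) {p : Submodule K V} (hp : IsInvariantOn ρ ⊤ p)
    (hdet : HasFiniteDetOn ρ ⊤ p) :
    ∃ P : Matrix ι ι K, LinearMap.IsProj (p.map (b.equivFun : V →ₗ[K] (ι → K))) P.mulVecLin ∧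
      ∃ m : ℕ, 0 < m ∧ ∀ g : G,
        (P * (toGL b (ρ g) : Matrix ι ι K) * P + (1 - P)).det ^ m = 1 := by
  have := b.finiteDimensional_of_finite
  obtain ⟨q, hpq⟩ := p.exists_isCompl
  obtain ⟨m, hm, hdet⟩ := hdet
  let π : V →ₗ[K] V := p.subtype ∘ₗ p.projectionOnto q hpq
  have hπ : LinearMap.IsProj p π :=
    ⟨fun v => (p.projectionOnto q hpq v).2, fun v hv =>
      congrArg Subtype.val (Submodule.projectionOnto_apply_left hpq ⟨v, hv⟩)⟩
  refine ⟨LinearMap.toMatrixAlgEquiv b π, ⟨fun w => ?_, ?_⟩, m, hm, fun g => ?_⟩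
  · obtain ⟨v, rfl⟩ := b.equivFun.surjective w
    exact ⟨π v, hπ.map_mem v, (toMatrixAlgEquiv_mulVec b π v).symm⟩
  · rintro _ ⟨v, hv, rfl⟩
    refine (toMatrixAlgEquiv_mulVec b π v).trans ?_
    rw [hπ.map_id v hv]
    rfl
  · have hg : ∀ v ∈ p, (ρ g : V →ₗ[K] V) v ∈ p := hp g (Subgroup.mem_top g)
    rw [coe_toGL, ← map_mul, ← map_mul, ← map_one (LinearMap.toMatrixAlgEquiv b), ← map_sub,
      ← map_add]
    have h : (LinearMap.toMatrixAlgEquiv b (π * (ρ g : V →ₗ[K] V) * π + (1 - π))).det =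
      LinearMap.det (π * (ρ g : V →ₗ[K] V) * π + (1 - π)) := LinearMap.det_toMatrix b _
    rw [h, det_compression hπ _ hg]
    exact hdet g (Subgroup.mem_top g) hg

theorem finiteIndex_monodromyGroup [CharZero K] [IsAlgClosed K] [FiniteDimensional K V]
    (hH : H.Normal) (hMH : IsConnectedAlgGroup (monodromyGroup (ρ.comp H.subtype)))
    (hsemisimple : IsSemisimpleOn ρ ⊤)
    (hconst : ∀ p : Submodule K V, IsSimpleOn ρ ⊤ p → IsSimpleOn ρ H p ∧ HasFiniteDetOn ρ ⊤ p) :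
    ((monodromyGroup (ρ.comp H.subtype)).subgroupOf (monodromyGroup ρ)).FiniteIndex := by
  let b := Module.finBasis K V
  let e := (toGL b).toMonoidHom
  have he : Function.Injective e := (toGL b).injective
  have hmul (g : G) (v : V) :
      (e (ρ g) : Matrix _ _ K) *ᵥ b.equivFun v = b.equivFun (ρ g v) :=
    toMatrixAlgEquiv_mulVec b (ρ g : V →ₗ[K] V) v
  have hΓ := isAlgClosure_map b ρ.range
  have hΔ := isAlgClosure_map b (ρ.comp H.subtype).range
  rw [← monodromyGroup_eq] at hΓ hΔ
  rw [Subgroup.finiteIndex_iff]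
  change (monodromyGroup (ρ.comp H.subtype)).relIndex (monodromyGroup ρ) ≠ 0
  rw [← Subgroup.relIndex_map_map_of_injective _ _ he]
  refine Subgroup.finiteIndex_iff.mp (hΓ.finiteIndex hΔ ?_ ?_ ?_
    (𝒮 := Submodule.map (b.equivFun : V →ₗ[K] _) '' {p | IsSimpleOn ρ ⊤ p}) ?_ ?_ ?_ ?_ ?_)
  · rintro _ ⟨_, ⟨h, rfl⟩, rfl⟩
    exact ⟨_, ⟨h, rfl⟩, rfl⟩
  · rintro _ ⟨_, ⟨g, rfl⟩, rfl⟩ _ ⟨_, ⟨h, rfl⟩, rfl⟩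
    exact ⟨_, ⟨⟨g * h * g⁻¹, hH.conj_mem h h.2 g⟩, rfl⟩, by simp⟩
  · intro S hS hSalg hfin
    rw [Subgroup.map_le_iff_le_comap]
    have hSle : S.comap e ≤ monodromyGroup (ρ.comp H.subtype) := by
      rw [← Subgroup.comap_map_eq_self_of_injective he (monodromyGroup (ρ.comp H.subtype))]
      exact Subgroup.comap_mono hS
    conv_lhs => rw [← hMH.2]
    refine identityComponent_le hSle (isZarClosed_comap b hSalg) (Subgroup.finiteIndex_iff.mpr ?_)
    change (S.comap e).relIndex _ ≠ 0
    rw [Subgroup.relIndex_comap]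
    exact hfin.index_ne_zero
  · have := (Submodule.orderIsoMapComap b.equivFun).map_sSup {p | IsSimpleOn ρ ⊤ p}
    rw [hsemisimple.sSup_isSimpleOn, OrderIso.map_top, ← sSup_image] at this
    exact this.symm
  · rintro _ ⟨p, hp, rfl⟩ h
    exact hp.2.1 ((Submodule.map_eq_bot_iff (e := b.equivFun)).mp h)
  · rintro _ ⟨p, hp, rfl⟩ _ ⟨_, ⟨g, rfl⟩, rfl⟩ _ ⟨v, hv, rfl⟩
    exact ⟨_, hp.1 g (Subgroup.mem_top g) v hv, (hmul g v).symm⟩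
  · rintro _ ⟨p, hp, rfl⟩ q hq hqinv
    have hq' : (q.comap (b.equivFun : V →ₗ[K] _)).map (b.equivFun : V →ₗ[K] _) = q :=
      Submodule.map_comap_eq_of_surjective b.equivFun.surjective q
    have hle : q.comap (b.equivFun : V →ₗ[K] _) ≤ p := by
      intro v hv
      obtain ⟨w, hw, hwv⟩ := hq hv
      exact b.equivFun.injective hwv ▸ hw
    have hinv : IsInvariantOn ρ H (q.comap (b.equivFun : V →ₗ[K] _)) := by
      intro h hh v hv
      rw [Submodule.mem_comap] at hv ⊢
      have := hqinv (e (ρ h)) ⟨_, ⟨⟨h, hh⟩, rfl⟩, rfl⟩ _ hv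
      exact hmul h v ▸ this
    rcases (hconst p hp).1.2.2 _ hle hinv with h | h
    · left
      rw [← hq', h, Submodule.map_bot]
    · right
      rw [← hq', h]
  · rintro _ ⟨p, hp, rfl⟩
    obtain ⟨P, hP, m, hm, h⟩ := exists_isProj_det_pow_eq_one b hp.1 (hconst p hp).2
    refine ⟨P, hP, m, hm, ?_⟩
    rintro _ ⟨_, ⟨g, rfl⟩, rfl⟩
    exact h g

lemma le_identityComponent {M N : Subgroup (V ≃ₗ[K] V)} (hNM : N ≤ M)
    (hN : IsConnectedAlgGroup N) : N ≤ identityComponent M := by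
  refine le_iInf₂ fun S hS => ?_
  have hfin : ((S ⊓ N).subgroupOf N).FiniteIndex := by
    rw [Subgroup.inf_subgroupOf_right, Subgroup.finiteIndex_iff]
    exact mt (Subgroup.relIndex_eq_zero_of_le_right hNM) hS.2.2.index_ne_zero
  have h := identityComponent_le inf_le_right (hS.2.1.inter hN.1) hfin
  rw [hN.2] at h
  exact h.trans inf_le_left

end Monodromy

/-- If the Zariski closure of `ρ(H)` is connected and semisimple, and `ρ` is admissible
relative to the normal subgroup `H` (semisimple, with simple constituents remaining
simple on `H` and having finite-order determinant), then the Zariski closure of `ρ(H)`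
equals the identity component of the Zariski closure of `ρ(G)`. -/
theorem monodromy_of_admissible_relative
    {K : Type*} [Field K] [CharZero K] [IsAlgClosed K]
    {V : Type*} [AddCommGroup V] [Module K V] [FiniteDimensional K V]
    {G : Type*} [Group G] (H : Subgroup G) (hH : H.Normal) (ρ : G →* (V ≃ₗ[K] V))
    (hMH : IsSemisimpleAlgGroup (monodromyGroup (ρ.comp H.subtype)))
    (hsemisimple : IsSemisimpleOn ρ ⊤)
    (hconst : ∀ p : Submodule K V, IsSimpleOn ρ ⊤ p →
      IsSimpleOn ρ H p ∧ HasFiniteDetOn ρ ⊤ p) :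
    monodromyGroup (ρ.comp H.subtype) = identityComponent (monodromyGroup ρ) := by
  have hle := monodromyGroup_comp_subtype_le H ρ
  exact le_antisymm (le_identityComponent hle hMH.1)
    (identityComponent_le hle hMH.1.1 (finiteIndex_monodromyGroup hH hMH.1 hsemisimple hconst))
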